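/- Let (X,T) be an invertible topological dynamical system and μ a T-ergodic Borel probability measure with h_μ(X,T) > 0, and set δ = sup{ d(x,y) : (x,y) ∈ E_μ(X,T) } > 0, where E_μ(X,T) is the set of entropy pairs for μ. Then there exists a Borel probability measure ν on X×X, both of whose coordinate projections equal μ, such that for ν-almost every pair (x,y): (i) lim_{n→+∞} d(T^n x, T^n y) = 0; and (ii) lim inf_{n→+∞} d(T^{-n} x, T^{-n} y) = 0 and lim sup_{n→+∞} d(T^{-n} x, T^{-n} y) ≥ δ. In particular, ν-almost every pair (x,y) is a Li–Yorke pair for T^{-1}. -/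

import Mathlib

open MeasureTheory Filter Topology Set
open scoped symmDiff Classical ENNReal NNReal

section Defs

variable {X : Type*}

/-- The pair `(x, y)` is (positively) asymptotic for `T`. -/
def IsAsymptoticPair [PseudoMetricSpace X] (T : X → X) (x y : X) : Prop :=
  Tendsto (fun n : ℕ => dist (T^[n] x) (T^[n] y)) atTop (𝓝 0)

/-- Shannon entropy of the finite measurable partition of `X` given by the fibers of a
map `p` into a finite type. -/
noncomputable def partEntropy [MeasurableSpace X] (μ : Measure X) {ι : Type*} [Fintype ι]
    (p : X → ι) : ℝ :=
  ∑ i : ι, Real.negMulLog (μ (p ⁻¹' {i})).toReal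

/-- Conditional Shannon entropy `H(P | F)` of the finite partition given by the fibers
of `p` with respect to the sub-σ-algebra `F`:
`H(P|F) = ∑_{A ∈ P} ∫ -E(1_A|F) log E(1_A|F) dμ`. -/
noncomputable def condPartEntropy [MeasurableSpace X] (μ : Measure X)
    (F : MeasurableSpace X) {ι : Type*} [Fintype ι] (p : X → ι) : ℝ :=
  ∑ i : ι, ∫ x, Real.negMulLog ((μ[(p ⁻¹' {i}).indicator (fun _ => (1 : ℝ)) | F]) x) ∂μ

/-- The σ-algebra `σ(P^-)` generated by the partitions `T^{-n}P`, `n ≥ 1`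
(the "past" of the partition given by the fibers of `p`). -/
def partPast (T : X → X) {ι : Type*} (p : X → ι) : MeasurableSpace X :=
  ⨆ n : ℕ, MeasurableSpace.comap (fun x => p (T^[n + 1] x)) ⊤

/-- The σ-algebra `σ(P^T)` generated by the partitions `T^{-n}P`, `n ∈ ℤ`, where `S = T⁻¹`. -/
def partHull (T S : X → X) {ι : Type*} (p : X → ι) : MeasurableSpace X :=
  ⨆ n : ℕ,
    MeasurableSpace.comap (fun x => p (T^[n] x)) ⊤ ⊔
      MeasurableSpace.comap (fun x => p (S^[n] x)) ⊤

/-- Kolmogorov–Sinai entropy of a finite partition: `h_μ(P, T) = H(P | P^-)`. -/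
noncomputable def partKS [MeasurableSpace X] (μ : Measure X) (T : X → X) {ι : Type*}
    [Fintype ι] (p : X → ι) : ℝ :=
  condPartEntropy μ (partPast T p) p

/-- Kolmogorov–Sinai (measure-theoretic) entropy `h_μ(X, T)` of the system:
the supremum over all finite measurable partitions `P` of `h_μ(P, T)`. -/
noncomputable def ksEntropy [MeasurableSpace X] (μ : Measure X) (T : X → X) : ℝ≥0∞ :=
  ⨆ (k : ℕ) (p : X → Fin k) (_ : Measurable p), ENNReal.ofReal (partKS μ T p)

/-- The Pinsker σ-algebra `Π_μ`: the σ-algebra generated by all finite measurable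
partitions with zero Kolmogorov–Sinai entropy. -/
def pinskerAlg [MeasurableSpace X] (μ : Measure X) (T : X → X) : MeasurableSpace X :=
  ⨆ (k : ℕ) (p : X → Fin k) (_ : Measurable p) (_ : partKS μ T p = 0),
    MeasurableSpace.comap p ⊤

/-- Minimal cardinality of a subcover of `⋁_{i=0}^{n-1} T^{-i} C`, where `C` is a
finite cover of `X`. -/
noncomputable def coverNum (T : X → X) {k : ℕ} (C : Fin k → Set X) (n : ℕ) : ℕ :=
  sInf {m : ℕ | ∃ f : Fin m → Fin n → Fin k,
    (⋃ j : Fin m, ⋂ i : Fin n, T^[(i : ℕ)] ⁻¹' C (f j i)) = Set.univ}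

/-- Topological entropy of a finite cover `C`:
`h(C, T) = inf_n (1/n) log N(⋁_{i=0}^{n-1} T^{-i} C) = lim_n (1/n) log N(...)`. -/
noncomputable def coverEntropyOf (T : X → X) {k : ℕ} (C : Fin k → Set X) : ℝ :=
  ⨅ n : ℕ, Real.log (coverNum T C (n + 1)) / (n + 1)

/-- `(x, y)` is a topological entropy pair: `x ≠ y` and every two-set open cover
`{Uᶜ, Vᶜ}`, where `U` and `V` are disjoint closed neighbourhoods of `x` and `y`,
has positive topological entropy. -/
def IsEntropyPair [TopologicalSpace X] (T : X → X) (x y : X) : Prop :=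
  x ≠ y ∧ ∀ U V : Set X, IsClosed U → IsClosed V → U ∈ 𝓝 x → V ∈ 𝓝 y → Disjoint U V →
    0 < coverEntropyOf T ![Uᶜ, Vᶜ]

/-- `(x, y)` is an entropy pair for the invariant measure `μ`: `x ≠ y` and every two-set
Borel partition `(A, Aᶜ)` with `x ∈ interior A` and `y ∈ interior Aᶜ` has positive
entropy with respect to `T` and `μ`. -/
def IsMuEntropyPair [TopologicalSpace X] [MeasurableSpace X] (T : X → X) (μ : Measure X)
    (x y : X) : Prop :=
  x ≠ y ∧ ∀ A : Set X, MeasurableSet A → x ∈ interior A → y ∈ interior Aᶜ →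
    0 < partKS μ T (fun z => if z ∈ A then (0 : Fin 2) else 1)

/-- `ν` is the relatively independent square `μ ⊠_G μ` of `μ` over the sub-σ-algebra `G`:
it is determined by `ν(A × B) = ∫ E(1_A|G) · E(1_B|G) dμ` for all Borel sets `A`, `B`. -/
def IsCondSquare (G : MeasurableSpace X) [m0 : MeasurableSpace X] (μ : Measure X)
    (ν : Measure (X × X)) : Prop :=
  ∀ A B : Set X, MeasurableSet[m0] A → MeasurableSet[m0] B →
    ν (A ×ˢ B) = ENNReal.ofReal
      (∫ x, (μ[A.indicator (fun _ => (1 : ℝ)) | G]) x *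
            (μ[B.indicator (fun _ => (1 : ℝ)) | G]) x ∂μ)

/-- The σ-algebra `m₁` is contained in `m₂` modulo `μ`-null sets. -/
def SubModNull [MeasurableSpace X] (μ : Measure X) (m₁ m₂ : MeasurableSpace X) : Prop :=
  ∀ A : Set X, MeasurableSet[m₁] A → ∃ B : Set X, MeasurableSet[m₂] B ∧ μ (A ∆ B) = 0

end Defs

section Defs2

variable {X : Type*}

/-- The σ-algebra `F^- = ⋁_{n ≥ 1} T^{-n} F`. -/
def pastAlg (T : X → X) (F : MeasurableSpace X) : MeasurableSpace X :=
  ⨆ n : ℕ, MeasurableSpace.comap (T^[n + 1]) F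

/-- The σ-algebra `F^T = ⋁_{n ∈ ℤ} T^{-n} F`, where `S = T⁻¹`. -/
def hullAlg (T S : X → X) (F : MeasurableSpace X) : MeasurableSpace X :=
  ⨆ n : ℕ, MeasurableSpace.comap (T^[n]) F ⊔ MeasurableSpace.comap (S^[n]) F

/-- `P` is (the σ-algebra of) an *excellent* measurable partition for `(X, μ, T)` (here
`S = T⁻¹`): it is generating (`σ(P^T) = 𝒜` mod `μ`) and it is generated by an increasing
sequence of finite measurable partitions `Pₙ ↑ P` with `H(Pₙ|Pₙ⁻) − H(Pₙ|P⁻) → 0`. -/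
def IsExcellentPartition (P : MeasurableSpace X) [m0 : MeasurableSpace X] (μ : Measure X)
    (T S : X → X) : Prop :=
  P ≤ m0 ∧ SubModNull μ m0 (hullAlg T S P) ∧
  ∃ (m : ℕ → ℕ) (Q : ∀ n : ℕ, X → Fin (m n)),
    (∀ n, Measurable (Q n)) ∧
    Monotone (fun n => MeasurableSpace.comap (Q n) (⊤ : MeasurableSpace (Fin (m n)))) ∧
    (⨆ n : ℕ, MeasurableSpace.comap (Q n) (⊤ : MeasurableSpace (Fin (m n)))) = P ∧
    Tendsto (fun n => condPartEntropy μ (partPast T (Q n)) (Q n) -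
      condPartEntropy μ (pastAlg T P) (Q n)) atTop (𝓝 0)

end Defs2

namespace BHR

set_option linter.unusedSectionVars false

variable {X : Type*} {F G : MeasurableSpace X} {m0 : MeasurableSpace X} {μ : Measure X} [IsProbabilityMeasure μ]

/-- Real indicator function of a set. -/
noncomputable def ind (A : Set X) : X → ℝ := A.indicator (fun _ => (1 : ℝ))

lemma ind_nonneg (A : Set X) (x : X) : 0 ≤ ind A x := by
  unfold ind; exact Set.indicator_nonneg (fun _ _ => zero_le_one) x

lemma ind_le_one (A : Set X) (x : X) : ind A x ≤ 1 := by
  unfold ind; exact Set.indicator_le_self' (fun _ _ => zero_le_one) x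

lemma ind_mem {A : Set X} {x : X} (h : x ∈ A) : ind A x = 1 := by simp [ind, h]

lemma ind_not_mem {A : Set X} {x : X} (h : x ∉ A) : ind A x = 0 := by simp [ind, h]

lemma measurable_ind {A : Set X} (hA : MeasurableSet[F] A) :
    Measurable[F] (ind A) := by
  unfold ind; exact measurable_const.indicator hA


lemma integrable_ind [IsFiniteMeasure μ] {A : Set X} (hA : MeasurableSet A) :
    Integrable (ind A) μ :=
  (integrable_const (1 : ℝ)).indicator hA

lemma cond_nonneg (A : Set X) :
    ∀ᵐ x ∂μ, 0 ≤ (μ[ind A | F]) x :=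
  condExp_nonneg (ae_of_all _ (ind_nonneg A))

lemma cond_le_one (hF : F ≤ m0) {A : Set X} (hA : MeasurableSet A) :
    ∀ᵐ x ∂μ, (μ[ind A | F]) x ≤ 1 := by
  have h := condExp_mono (m := F) (integrable_ind (μ := μ) hA) (integrable_const (1 : ℝ))
    (ae_of_all _ (ind_le_one A))
  rw [condExp_const hF] at h
  exact h

lemma cond_mono {A B : Set X} (hA : MeasurableSet A)
    (hB : MeasurableSet B) (hAB : A ⊆ B) :
    ∀ᵐ x ∂μ, (μ[ind A | F]) x ≤ (μ[ind B | F]) x :=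
  condExp_mono (integrable_ind hA) (integrable_ind hB)
    (ae_of_all _ (fun x => Set.indicator_le_indicator_of_subset hAB (fun _ => zero_le_one) x))

lemma abs_negMulLog_le {t : ℝ} (h0 : 0 ≤ t) (h1 : t ≤ 1) : |Real.negMulLog t| ≤ 1 := by
  rw [abs_of_nonneg (Real.negMulLog_nonneg h0 h1)]
  linarith [Real.negMulLog_le_one_sub_self h0]


lemma integrable_of_bdd [IsFiniteMeasure μ] {f : X → ℝ} (hf : AEStronglyMeasurable f μ) (C : ℝ)
    (h : ∀ᵐ x ∂μ, |f x| ≤ C) : Integrable f μ :=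
  Integrable.of_bound hf C h

lemma cond_meas (hF : F ≤ m0) (f : X → ℝ) :
    Measurable (μ[f | F]) := (stronglyMeasurable_condExp.mono hF).measurable

lemma integrable_negMulLog_cond (hF : F ≤ m0) {A : Set X}
    (hA : MeasurableSet A) : Integrable (fun x => Real.negMulLog ((μ[ind A | F]) x)) μ := by
  refine integrable_of_bdd
    ((Real.continuous_negMulLog.measurable.comp (cond_meas hF _)).aestronglyMeasurable) 1 ?_
  filter_upwards [cond_nonneg (F := F) (μ := μ) A, cond_le_one (μ := μ) hF hA] with x h0 h1
  exact abs_negMulLog_le h0 h1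

lemma condPartEntropy_def' {ι : Type*} [Fintype ι] (p : X → ι) :
    condPartEntropy μ F p = ∑ i, ∫ x, Real.negMulLog ((μ[ind (p ⁻¹' {i}) | F]) x) ∂μ := rfl

section basic

variable {ι κ : Type*} [Fintype ι] [Fintype κ]

lemma entropy_nonneg (hF : F ≤ m0) (p : X → ι)
    (hp : ∀ i, MeasurableSet (p ⁻¹' {i})) : 0 ≤ condPartEntropy μ F p := by
  rw [condPartEntropy_def']
  refine Finset.sum_nonneg fun i _ => integral_nonneg_of_ae ?_
  filter_upwards [cond_nonneg (F := F) (μ := μ) (p ⁻¹' {i}), cond_le_one (μ := μ) hF (hp i)] with x h0 h1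
  exact Real.negMulLog_nonneg h0 h1

lemma entropy_anti (hFG : F ≤ G) (hG : G ≤ m0) (p : X → ι)
    (hp : ∀ i, MeasurableSet (p ⁻¹' {i})) : condPartEntropy μ G p ≤ condPartEntropy μ F p := by
  rw [condPartEntropy_def', condPartEntropy_def']
  refine Finset.sum_le_sum fun i _ => ?_
  have hF := hFG.trans hG
  set A := p ⁻¹' {i}
  have hj := ConcaveOn.condExp_map_le (μ := μ) (f := μ[ind A | G]) hF Real.concaveOn_negMulLog
    (Real.continuous_negMulLog.upperSemicontinuous.upperSemicontinuousOn _)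
    (cond_nonneg A) isClosed_Ici integrable_condExp (integrable_negMulLog_cond hG (hp i))
  have ht : μ[μ[ind A | G] | F] =ᵐ[μ] μ[ind A | F] := condExp_condExp_of_le hFG hG
  calc ∫ x, Real.negMulLog ((μ[ind A | G]) x) ∂μ
      = ∫ x, (μ[Real.negMulLog ∘ μ[ind A | G] | F]) x ∂μ := (integral_condExp hF).symm
    _ ≤ _ := by
      refine integral_mono_ae integrable_condExp (integrable_negMulLog_cond hF (hp i)) ?_
      filter_upwards [hj, ht] with x h1 h2
      rw [← h2]; exact h1

lemma entropy_zero (hF : F ≤ m0) (p : X → ι)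
    (hp : ∀ i, MeasurableSet[F] (p ⁻¹' {i})) : condPartEntropy μ F p = 0 := by
  rw [condPartEntropy_def']
  refine Finset.sum_eq_zero fun i _ => ?_
  rw [condExp_of_stronglyMeasurable hF (measurable_ind (hp i)).stronglyMeasurable
    (integrable_ind (hF _ (hp i)))]
  refine integral_eq_zero_of_ae (ae_of_all _ fun x => ?_)
  by_cases h : x ∈ p ⁻¹' {i}
  · simp [ind_mem h]
  · simp [ind_not_mem h]

lemma entropy_tendsto (F : ℕ → MeasurableSpace X) (hm : Monotone F) (hF : ∀ n, F n ≤ m0)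
    (p : X → ι) (hp : ∀ i, MeasurableSet (p ⁻¹' {i})) :
    Tendsto (fun n => condPartEntropy μ (F n) p) atTop (𝓝 (condPartEntropy μ (⨆ n, F n) p)) := by
  simp only [condPartEntropy_def']
  refine tendsto_finsetSum _ fun i _ => ?_
  let ℱ : Filtration ℕ m0 := ⟨F, hm, hF⟩
  refine tendsto_integral_of_dominated_convergence (fun _ => (1 : ℝ))
    (fun n => (integrable_negMulLog_cond (hF n) (hp i)).aestronglyMeasurable)
    (integrable_const _) (fun n => ?_) ?_
  · filter_upwards [cond_nonneg (F := F n) (μ := μ) (p ⁻¹' {i}), cond_le_one (μ := μ) (hF n) (hp i)]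
      with x h0 h1
    exact abs_negMulLog_le h0 h1
  · filter_upwards [tendsto_ae_condExp (μ := μ) (ℱ := ℱ) (ind (p ⁻¹' {i}))] with x hx
    exact (Real.continuous_negMulLog.tendsto _).comp hx

lemma entropy_congr_ae {p q : X → ι} (h : p =ᵐ[μ] q) :
    condPartEntropy μ F p = condPartEntropy μ F q := by
  rw [condPartEntropy_def', condPartEntropy_def']
  refine Finset.sum_congr rfl fun i _ => integral_congr_ae ?_
  have : μ[ind (p ⁻¹' {i}) | F] =ᵐ[μ] μ[ind (q ⁻¹' {i}) | F] := by
    refine condExp_congr_ae ?_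
    filter_upwards [h] with x hx
    simp [ind, Set.indicator, hx]
  filter_upwards [this] with x hx
  rw [hx]

lemma entropy_comp_inj (p : X → ι) (e : ι → κ)
    (he : Function.Injective e) :
    condPartEntropy μ F (fun x => e (p x)) = condPartEntropy μ F p := by
  rw [condPartEntropy_def', condPartEntropy_def']
  have h1 : ∀ i, (fun x => e (p x)) ⁻¹' {e i} = p ⁻¹' {i} := by
    intro i; ext x; simp [he.eq_iff]
  have h2 : ∀ j, j ∉ Finset.univ.image e →
      ∫ x, Real.negMulLog ((μ[ind ((fun x => e (p x)) ⁻¹' {j}) | F]) x) ∂μ = 0 := by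
    intro j hj
    have : (fun x => e (p x)) ⁻¹' {j} = ∅ := by
      ext x; simp at hj; simp [hj]
    rw [this]
    have h0 : ind (∅ : Set X) = 0 := by ext; simp [ind]
    simp [h0, condExp_zero]
  rw [← Finset.sum_subset (Finset.subset_univ (Finset.univ.image e)) (fun j _ hj => h2 j hj),
    Finset.sum_image (fun a _ b _ h => he h)]
  simp only [h1]

/-- Sets of `F ⊔ σ(q)` agree with sets of `F` on the fibers of `q`. -/
lemma exists_trace (q : X → κ) {s : Set X}
    (hs : MeasurableSet[F ⊔ MeasurableSpace.comap q ⊤] s) (j : κ) :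
    ∃ A, MeasurableSet[F] A ∧ s ∩ q ⁻¹' {j} = A ∩ q ⁻¹' {j} := by
  let M : MeasurableSpace X := @MeasurableSpace.mk X
    (fun s => ∃ A, MeasurableSet[F] A ∧ s ∩ q ⁻¹' {j} = A ∩ q ⁻¹' {j})
    (⟨∅, MeasurableSet.empty, rfl⟩)
    (by
        rintro s ⟨A, hA, h⟩
        refine ⟨Aᶜ, hA.compl, ?_⟩
        ext x
        have := Set.ext_iff.1 h x
        simp only [mem_inter_iff, mem_compl_iff] at this ⊢
        tauto)
    (by
        intro f hf
        choose A hA h using hf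
        refine ⟨⋃ n, A n, MeasurableSet.iUnion hA, ?_⟩
        rw [iUnion_inter, iUnion_inter]
        exact iUnion_congr h)
  have h1 : F ≤ M := fun s hs => ⟨s, hs, rfl⟩
  have h2 : MeasurableSpace.comap q ⊤ ≤ M := by
    rintro s ⟨B, -, rfl⟩
    by_cases hj : j ∈ B
    · refine ⟨univ, @MeasurableSet.univ X F, ?_⟩
      ext x; simp only [mem_inter_iff, mem_preimage, mem_singleton_iff, mem_univ, true_and]
      constructor
      · exact fun h => h.2
      · rintro rfl; exact ⟨hj, rfl⟩
    · refine ⟨∅, @MeasurableSet.empty X F, ?_⟩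
      ext x; simp only [mem_inter_iff, mem_preimage, mem_singleton_iff, mem_empty_iff_false,
        false_and, iff_false]
      rintro ⟨h, rfl⟩; exact hj h
  exact (sup_le h1 h2) s hs

lemma integral_mul_pull (hF : F ≤ m0) {f g : X → ℝ}
    (hf : StronglyMeasurable[F] f) (hfg : Integrable (fun x => f x * g x) μ) (hg : Integrable g μ) :
    ∫ x, f x * g x ∂μ = ∫ x, f x * (μ[g | F]) x ∂μ := by
  have := condExp_mul_of_stronglyMeasurable_left (μ := μ) hf hfg hg
  rw [← integral_condExp hF (f := fun x => f x * g x)]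
  exact integral_congr_ae this

end basic

end BHR


namespace BHR

set_option linter.unusedSectionVars false

variable {X : Type*} {F G : MeasurableSpace X} {m0 : MeasurableSpace X} {μ : Measure X}
  [IsProbabilityMeasure μ]
variable {ι κ : Type*} [Fintype ι] [Fintype κ]

lemma comap_top_le {q : X → κ} (hq : ∀ j, MeasurableSet (q ⁻¹' {j})) :
    MeasurableSpace.comap q ⊤ ≤ m0 := by
  rintro s ⟨B, -, rfl⟩
  have : q ⁻¹' B = ⋃ j ∈ B, q ⁻¹' {j} := by ext; simp
  rw [this]
  exact MeasurableSet.biUnion (Set.to_countable B) fun j _ => hq j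

/-- The conditional probability given `F ⊔ σ(q)`. -/
lemma cond_sup (hF : F ≤ m0) (q : X → κ) (hq : ∀ j, MeasurableSet (q ⁻¹' {j}))
    {B : Set X} (hB : MeasurableSet B) :
    (fun x => ∑ j, ind (q ⁻¹' {j}) x *
      ((μ[ind (B ∩ q ⁻¹' {j}) | F]) x / (μ[ind (q ⁻¹' {j}) | F]) x)) =ᵐ[μ]
      μ[ind B | F ⊔ MeasurableSpace.comap q ⊤] := by
  have hqc := comap_top_le hq
  have hle : F ⊔ MeasurableSpace.comap q ⊤ ≤ m0 := sup_le hF hqc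
  have hBj : ∀ j, MeasurableSet (B ∩ q ⁻¹' {j}) := fun j => hB.inter (hq j)
  set h : κ → X → ℝ := fun j x => (μ[ind (B ∩ q ⁻¹' {j}) | F]) x / (μ[ind (q ⁻¹' {j}) | F]) x
    with hh
  have hmF : ∀ j, Measurable[F] (h j) := fun j =>
    stronglyMeasurable_condExp.measurable.div stronglyMeasurable_condExp.measurable
  have hb : ∀ j, ∀ᵐ x ∂μ, |h j x| ≤ 1 := by
    intro j
    filter_upwards [cond_nonneg (F := F) (μ := μ) (B ∩ q ⁻¹' {j}),
      cond_nonneg (F := F) (μ := μ) (q ⁻¹' {j}),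
      cond_mono (F := F) (μ := μ) (hBj j) (hq j) inter_subset_right] with x h1 h2 h3
    rw [abs_of_nonneg (div_nonneg h1 h2)]
    exact div_le_one_of_le₀ h3 h2
  have hintg : ∀ j, Integrable (fun x => h j x * ind (q ⁻¹' {j}) x) μ := by
    intro j
    refine integrable_of_bdd
      (((hmF j).mono hF le_rfl).mul (measurable_ind (hq j))).aestronglyMeasurable 1 ?_
    filter_upwards [hb j] with x hx
    rw [abs_mul, abs_of_nonneg (ind_nonneg _ x)]
    nlinarith [ind_le_one (q ⁻¹' {j}) x, ind_nonneg (q ⁻¹' {j}) x, abs_nonneg (h j x)]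
  have hintg' : ∀ j, Integrable (fun x => ind (q ⁻¹' {j}) x * h j x) μ := fun j => by
    simpa only [mul_comm] using hintg j
  have hpull : ∀ j, ∀ A, MeasurableSet[F] A →
      ∫ x in A, ind (q ⁻¹' {j}) x * h j x ∂μ = ∫ x in A, ind (B ∩ q ⁻¹' {j}) x ∂μ := by
    intro j A hA
    have e1 : μ[fun x => h j x * ind (q ⁻¹' {j}) x | F] =ᵐ[μ]
        h j * μ[ind (q ⁻¹' {j}) | F] :=
      condExp_mul_of_stronglyMeasurable_left (hmF j).stronglyMeasurable (hintg j)
        (integrable_ind (hq j))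
    have e2 : h j * μ[ind (q ⁻¹' {j}) | F] =ᵐ[μ] μ[ind (B ∩ q ⁻¹' {j}) | F] := by
      filter_upwards [cond_nonneg (F := F) (μ := μ) (B ∩ q ⁻¹' {j}),
        cond_mono (F := F) (μ := μ) (hBj j) (hq j) inter_subset_right] with x h1 h3
      simp only [Pi.mul_apply, hh]
      by_cases h0 : (μ[ind (q ⁻¹' {j}) | F]) x = 0
      · rw [h0] at h3 ⊢; simp; linarith
      · field_simp
    calc ∫ x in A, ind (q ⁻¹' {j}) x * h j x ∂μ
        = ∫ x in A, h j x * ind (q ⁻¹' {j}) x ∂μ := by simp only [mul_comm]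
      _ = ∫ x in A, (μ[fun x => h j x * ind (q ⁻¹' {j}) x | F]) x ∂μ :=
          (setIntegral_condExp hF (hintg j) hA).symm
      _ = ∫ x in A, (μ[ind (B ∩ q ⁻¹' {j}) | F]) x ∂μ := by
          refine setIntegral_congr_ae (hF _ hA) ?_
          filter_upwards [e1.trans e2] with x hx _ using hx
      _ = _ := setIntegral_condExp hF (integrable_ind (hBj j)) hA
  refine ae_eq_condExp_of_forall_setIntegral_eq hle (integrable_ind hB)
    (fun s _ _ => (integrable_finsetSum _ fun j _ => hintg' j).integrableOn) ?_ ?_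
  · intro s hs _
    have hs0 := hle _ hs
    rw [integral_finsetSum _ fun j _ => (hintg' j).integrableOn]
    have hsum : ∀ x, ind B x = ∑ j, ind (B ∩ q ⁻¹' {j}) x := by
      intro x
      by_cases hx : x ∈ B
      · rw [Finset.sum_eq_single (q x)]
        · rw [ind_mem hx, ind_mem]; exact ⟨hx, rfl⟩
        · intro j _ hj; exact ind_not_mem fun hc => hj hc.2.symm
        · simp
      · rw [ind_not_mem hx, Finset.sum_eq_zero]
        intro j _; exact ind_not_mem fun hc => hx hc.1
    simp only [hsum]
    rw [integral_finsetSum _ fun j _ => (integrable_ind (hBj j)).integrableOn]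
    refine Finset.sum_congr rfl fun j _ => ?_
    obtain ⟨A, hA, hsA⟩ := exists_trace q hs j
    have key : ∀ f : X → ℝ, (∀ x, x ∉ q ⁻¹' {j} → f x = 0) →
        ∫ x in s, f x ∂μ = ∫ x in A, f x ∂μ := by
      intro f hf
      rw [← integral_indicator hs0, ← integral_indicator (hF _ hA)]
      congr 1; ext x
      by_cases hx : x ∈ q ⁻¹' {j}
      · have := Set.ext_iff.1 hsA x
        simp only [mem_inter_iff, hx, and_true] at this
        simp [Set.indicator, this]
      · simp [Set.indicator, hf x hx]
    rw [key, key, hpull j A hA]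
    · intro x hx; exact ind_not_mem fun hc => hx hc.2
    · intro x hx; rw [ind_not_mem hx, zero_mul]
  · refine Measurable.aestronglyMeasurable ?_
    refine Finset.measurable_sum _ fun j _ => Measurable.mul ?_ ?_
    · exact measurable_ind
        ((le_sup_right : _ ≤ F ⊔ MeasurableSpace.comap q ⊤) _ ⟨{j}, trivial, rfl⟩)
    · exact (hmF j).mono le_sup_left le_rfl

/-- Chain rule for conditional entropy. -/
lemma entropy_chain (hF : F ≤ m0) (p : X → ι) (q : X → κ)
    (hp : ∀ i, MeasurableSet (p ⁻¹' {i})) (hq : ∀ j, MeasurableSet (q ⁻¹' {j})) :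
    condPartEntropy μ F (fun x => (p x, q x)) =
      condPartEntropy μ F q + condPartEntropy μ (F ⊔ MeasurableSpace.comap q ⊤) p := by
  have hpq : ∀ i j, MeasurableSet (p ⁻¹' {i} ∩ q ⁻¹' {j}) := fun i j => (hp i).inter (hq j)
  set P : ι → κ → X → ℝ := fun i j => μ[ind (p ⁻¹' {i} ∩ q ⁻¹' {j}) | F] with hP
  set Q : κ → X → ℝ := fun j => μ[ind (q ⁻¹' {j}) | F] with hQ
  have hPm : ∀ i j, StronglyMeasurable[F] (P i j) := fun i j => stronglyMeasurable_condExp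
  have hQm : ∀ j, StronglyMeasurable[F] (Q j) := fun j => stronglyMeasurable_condExp
  have hP0 : ∀ i j, ∀ᵐ x ∂μ, 0 ≤ P i j x := fun i j => cond_nonneg _
  have hPQ : ∀ i j, ∀ᵐ x ∂μ, P i j x ≤ Q j x := fun i j =>
    cond_mono (hpq i j) (hq j) inter_subset_right
  have hQ0 : ∀ j, ∀ᵐ x ∂μ, 0 ≤ Q j x := fun j => cond_nonneg _
  have hQ1 : ∀ j, ∀ᵐ x ∂μ, Q j x ≤ 1 := fun j => cond_le_one hF (hq j)
  have hsumP : ∀ j, ∀ᵐ x ∂μ, ∑ i, P i j x = Q j x := by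
    intro j
    have e : ind (q ⁻¹' {j}) = ∑ i, ind (p ⁻¹' {i} ∩ q ⁻¹' {j}) := by
      ext x
      rw [Finset.sum_apply]
      by_cases hx : x ∈ q ⁻¹' {j}
      · rw [Finset.sum_eq_single (p x)]
        · rw [ind_mem hx, ind_mem]; exact ⟨rfl, hx⟩
        · intro i _ hi; exact ind_not_mem fun hc => hi hc.1.symm
        · simp
      · rw [ind_not_mem hx, Finset.sum_eq_zero]
        intro i _; exact ind_not_mem fun hc => hx hc.2
    have := condExp_finsetSum (μ := μ) (s := Finset.univ)
      (f := fun i => ind (p ⁻¹' {i} ∩ q ⁻¹' {j})) (fun i _ => integrable_ind (hpq i j)) F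
    simp only [hQ, hP]
    rw [e]
    filter_upwards [this] with x hx
    rw [hx, Finset.sum_apply]
  have hφm : ∀ i j, StronglyMeasurable[F] (fun x => Real.negMulLog (P i j x / Q j x)) := by
    intro i j
    exact (Real.continuous_negMulLog.measurable.comp
      ((hPm i j).measurable.div (hQm j).measurable)).stronglyMeasurable
  have hφb : ∀ i j, ∀ᵐ x ∂μ, |Real.negMulLog (P i j x / Q j x)| ≤ 1 := by
    intro i j
    filter_upwards [hP0 i j, hPQ i j, hQ0 j] with x h1 h2 h3
    exact abs_negMulLog_le (div_nonneg h1 h3) (div_le_one_of_le₀ h2 h3)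
  have hI1 : ∀ i j, Integrable
      (fun x => Real.negMulLog (P i j x / Q j x) * ind (q ⁻¹' {j}) x) μ := by
    intro i j
    refine integrable_of_bdd
      (((hφm i j).mono hF).measurable.mul (measurable_ind (hq j))).aestronglyMeasurable 1 ?_
    filter_upwards [hφb i j] with x hx
    rw [abs_mul, abs_of_nonneg (ind_nonneg _ x)]
    nlinarith [ind_le_one (q ⁻¹' {j}) x, ind_nonneg (q ⁻¹' {j}) x,
      abs_nonneg (Real.negMulLog (P i j x / Q j x))]
  have hI2 : ∀ i j, Integrable (fun x => Real.negMulLog (P i j x / Q j x) * Q j x) μ := by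
    intro i j
    refine integrable_of_bdd
      (((hφm i j).mono hF).measurable.mul ((hQm j).mono hF).measurable).aestronglyMeasurable 1 ?_
    filter_upwards [hφb i j, hQ0 j, hQ1 j] with x hx h0 h1
    rw [abs_mul, abs_of_nonneg h0]
    nlinarith [abs_nonneg (Real.negMulLog (P i j x / Q j x))]
  -- the second term
  have h2 : condPartEntropy μ (F ⊔ MeasurableSpace.comap q ⊤) p =
      ∑ j, ∑ i, ∫ x, Real.negMulLog (P i j x / Q j x) * Q j x ∂μ := by
    rw [condPartEntropy_def', Finset.sum_comm]
    refine Finset.sum_congr rfl fun i _ => ?_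
    rw [← integral_finsetSum _ (fun j _ => hI2 i j)]
    have : ∫ x, Real.negMulLog ((μ[ind (p ⁻¹' {i}) | F ⊔ MeasurableSpace.comap q ⊤]) x) ∂μ =
        ∫ x, ∑ j, Real.negMulLog (P i j x / Q j x) * ind (q ⁻¹' {j}) x ∂μ := by
      refine integral_congr_ae ?_
      filter_upwards [cond_sup (μ := μ) hF q hq (hp i)] with x hx
      rw [← hx, Finset.sum_eq_single (q x), Finset.sum_eq_single (q x), ind_mem (by rfl)]
      · simp [hP, hQ]
      · intro j _ hj; rw [ind_not_mem (fun hc => hj hc.symm), mul_zero]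
      · simp
      · intro j _ hj; rw [ind_not_mem (fun hc => hj hc.symm), zero_mul]
      · simp
    rw [this, integral_finsetSum _ (fun j _ => hI1 i j), integral_finsetSum _ (fun j _ => hI2 i j)]
    exact Finset.sum_congr rfl fun j _ =>
      integral_mul_pull hF (hφm i j) (hI1 i j) (integrable_ind (hq j))
  rw [h2, condPartEntropy_def', condPartEntropy_def', Fintype.sum_prod_type, Finset.sum_comm,
    ← Finset.sum_add_distrib]
  refine Finset.sum_congr rfl fun j _ => ?_
  have e3 : ∀ i, (fun x => (p x, q x)) ⁻¹' {(i, j)} = p ⁻¹' {i} ∩ q ⁻¹' {j} := by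
    intro i; ext x; simp
  simp only [e3]
  rw [← integral_finsetSum _ (fun i _ => integrable_negMulLog_cond hF (hpq i j)),
    ← integral_finsetSum _ (fun i _ => hI2 i j),
    ← integral_add (integrable_negMulLog_cond hF (hq j))
      (integrable_finsetSum _ fun i _ => hI2 i j)]
  refine integral_congr_ae ?_
  filter_upwards [hsumP j, ae_all_iff.2 fun i => hP0 i j, ae_all_iff.2 fun i => hPQ i j]
    with x h1 h2 h3
  change ∑ i, Real.negMulLog (P i j x) = Real.negMulLog (Q j x) +
    ∑ i, Real.negMulLog (P i j x / Q j x) * Q j x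
  by_cases h0 : Q j x = 0
  · have : ∀ i, P i j x = 0 := fun i => le_antisymm (h0 ▸ h3 i) (h2 i)
    simp [h0, this]
  · have hk : ∀ i, Real.negMulLog (P i j x) =
        P i j x / Q j x * Real.negMulLog (Q j x) +
          Real.negMulLog (P i j x / Q j x) * Q j x := by
      intro i
      have := Real.negMulLog_mul (Q j x) (P i j x / Q j x)
      rw [mul_div_cancel₀ _ h0] at this
      rw [this]; ring
    rw [Finset.sum_congr rfl fun i _ => hk i, Finset.sum_add_distrib, ← Finset.sum_mul,
      ← Finset.sum_div, h1, div_self h0, one_mul]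

end BHR


namespace BHR

set_option linter.unusedSectionVars false

variable {X : Type*} {F G : MeasurableSpace X} {m0 : MeasurableSpace X} {μ : Measure X}
  [IsProbabilityMeasure μ]
variable {ι κ τ : Type*} [Fintype ι] [Fintype κ] [Fintype τ]

/-- The σ-algebra generated by a finite partition. -/
def sg {ι : Type*} (p : X → ι) : MeasurableSpace X := MeasurableSpace.comap p ⊤

/-- Measurability of a finite partition. -/
def MP {ι : Type*} [MeasurableSpace X] (p : X → ι) : Prop := ∀ i, MeasurableSet (p ⁻¹' {i})

lemma sg_le {p : X → ι} (hp : MP p) : sg p ≤ m0 := comap_top_le hp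

lemma MP_of_sg_le {p : X → ι} (hp : sg p ≤ m0) : MP p := fun i => hp _ ⟨{i}, trivial, rfl⟩

lemma sg_comp (p : X → ι) (T : X → X) :
    sg (fun x => p (T x)) = MeasurableSpace.comap T (sg p) := by
  unfold sg; rw [MeasurableSpace.comap_comp]; rfl

lemma sg_fun (p : X → ι) (f : ι → κ) : sg (fun x => f (p x)) ≤ sg p := by
  rintro s ⟨B, -, rfl⟩; exact ⟨f ⁻¹' B, trivial, rfl⟩

lemma MP_prod {p : X → ι} {q : X → κ} (hp : MP p) (hq : MP q) : MP (fun x => (p x, q x)) := by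
  rintro ⟨i, j⟩
  have : (fun x => (p x, q x)) ⁻¹' {(i, j)} = p ⁻¹' {i} ∩ q ⁻¹' {j} := by ext x; simp
  rw [this]; exact (hp i).inter (hq j)

lemma sg_prod (p : X → ι) (q : X → κ) : sg (fun x => (p x, q x)) = sg p ⊔ sg q := by
  refine le_antisymm ?_ (sup_le ?_ ?_)
  · let _ : MeasurableSpace X := sg p ⊔ sg q
    refine sg_le (MP_prod ?_ ?_)
    · exact MP_of_sg_le le_sup_left
    · exact MP_of_sg_le le_sup_right
  · exact sg_fun (fun x => (p x, q x)) Prod.fst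
  · exact sg_fun (fun x => (p x, q x)) Prod.snd

lemma MP_comp {p : X → ι} (hp : MP p) {T : X → X} (hT : Measurable T) :
    MP (fun x => p (T x)) := fun i => hT (hp i)

lemma MP_fun {p : X → ι} (hp : MP p) (f : ι → κ) : MP (fun x => f (p x)) :=
  MP_of_sg_le ((sg_fun p f).trans (sg_le hp))

/-- Chain rule, restated. -/
lemma chain (hF : F ≤ m0) {p : X → ι} {q : X → κ} (hp : MP p) (hq : MP q) :
    condPartEntropy μ F (fun x => (p x, q x)) =
      condPartEntropy μ F q + condPartEntropy μ (F ⊔ sg q) p :=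
  entropy_chain hF p q hp hq

lemma chain' (hF : F ≤ m0) {p : X → ι} {q : X → κ} (hp : MP p) (hq : MP q) :
    condPartEntropy μ F (fun x => (p x, q x)) =
      condPartEntropy μ F p + condPartEntropy μ (F ⊔ sg p) q := by
  rw [← chain hF hq hp]
  exact entropy_comp_inj (F := F) (fun x => (q x, p x)) Prod.swap Prod.swap_injective

lemma ent_anti (hFG : F ≤ G) (hG : G ≤ m0) {p : X → ι} (hp : MP p) :
    condPartEntropy μ G p ≤ condPartEntropy μ F p := entropy_anti hFG hG p hp

lemma ent_nonneg (hF : F ≤ m0) {p : X → ι} (hp : MP p) : 0 ≤ condPartEntropy μ F p :=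
  entropy_nonneg hF p hp

lemma ent_zero (hF : F ≤ m0) {p : X → ι} (hp : sg p ≤ F) : condPartEntropy μ F p = 0 :=
  entropy_zero hF p fun i => hp _ ⟨{i}, trivial, rfl⟩

lemma ent_sub (hF : F ≤ m0) {p : X → ι} {q : X → κ} (hp : MP p) (hq : MP q) :
    condPartEntropy μ F (fun x => (p x, q x)) ≤
      condPartEntropy μ F p + condPartEntropy μ F q := by
  rw [chain hF hp hq, add_comm]
  gcongr
  exact ent_anti le_sup_left (sup_le hF (sg_le hq)) hp

/-- A finer partition has bigger entropy. -/
lemma ent_mono (hF : F ≤ m0) {p : X → ι} {q : X → κ} (hq : MP q) (h : sg p ≤ F ⊔ sg q) :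
    condPartEntropy μ F p ≤ condPartEntropy μ F q := by
  have hle : F ⊔ sg q ≤ m0 := sup_le hF (sg_le hq)
  have hp : MP p := MP_of_sg_le (h.trans hle)
  have h1 := chain (μ := μ) hF hp hq
  rw [ent_zero hle h, add_zero, chain' hF hp hq] at h1
  linarith [ent_nonneg (μ := μ) (F := F ⊔ sg p) (sup_le hF (sg_le hp)) hq]

lemma ent_refine (hF : F ≤ m0) {p : X → ι} {q : X → κ} (hq : MP q) (h : sg p ≤ sg q) :
    condPartEntropy μ F q =
      condPartEntropy μ F p + condPartEntropy μ (F ⊔ sg p) q := by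
  have hp : MP p := MP_of_sg_le (h.trans (sg_le hq))
  have h1 := chain (μ := μ) hF hp hq
  rw [ent_zero (sup_le hF (sg_le hq)) (h.trans le_sup_right), add_zero, chain' hF hp hq] at h1
  exact h1.symm

/-- Loss of entropy is bigger for a finer partition. -/
lemma ent_loss (hFG : F ≤ G) (hG : G ≤ m0) {p : X → ι} {q : X → κ} (hq : MP q)
    (h : sg p ≤ sg q) :
    condPartEntropy μ F p - condPartEntropy μ G p ≤
      condPartEntropy μ F q - condPartEntropy μ G q := by
  have hF := hFG.trans hG
  have hp : MP p := MP_of_sg_le (h.trans (sg_le hq))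
  have := ent_anti (μ := μ) (sup_le_sup_right hFG (sg p)) (sup_le hG (sg_le hp)) hq
  rw [ent_refine hF hq h, ent_refine hG hq h]; linarith

lemma condExp_comp' {T : X → X} (hT : MeasurePreserving T μ μ) (hG : G ≤ m0) {f : X → ℝ}
    (hf : Integrable f μ) :
    μ[f ∘ T | MeasurableSpace.comap T G] =ᵐ[μ] (μ[f | G]) ∘ T := by
  have hle : MeasurableSpace.comap T G ≤ m0 :=
    (MeasurableSpace.comap_mono hG).trans hT.measurable.comap_le
  symm
  refine ae_eq_condExp_of_forall_setIntegral_eq hle (hT.integrable_comp_of_integrable hf)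
    (fun s _ _ => (hT.integrable_comp_of_integrable integrable_condExp).integrableOn) ?_ ?_
  · rintro s ⟨A, hA, rfl⟩ _
    have key : ∀ g : X → ℝ, Integrable g μ →
        ∫ x in T ⁻¹' A, (g ∘ T) x ∂μ = ∫ x in A, g x ∂μ := by
      intro g hg
      have := setIntegral_map (μ := μ) (g := T) (f := g) (hG _ hA)
        (by rw [hT.map_eq]; exact hg.aestronglyMeasurable) hT.measurable.aemeasurable
      rw [hT.map_eq] at this
      exact this.symm
    rw [key _ integrable_condExp, key _ hf, setIntegral_condExp hG hf hA]
  · refine Measurable.aestronglyMeasurable ?_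
    exact stronglyMeasurable_condExp.measurable.comp (Measurable.of_comap_le le_rfl)

lemma ent_comp {T : X → X} (hT : MeasurePreserving T μ μ) (hG : G ≤ m0) {p : X → ι}
    (hp : MP p) : condPartEntropy μ (MeasurableSpace.comap T G) (fun x => p (T x)) =
      condPartEntropy μ G p := by
  rw [condPartEntropy_def', condPartEntropy_def']
  refine Finset.sum_congr rfl fun i _ => ?_
  have h1 : ind ((fun x => p (T x)) ⁻¹' {i}) = ind (p ⁻¹' {i}) ∘ T := by
    ext x; simp [ind, Set.indicator]
  have h2 := condExp_comp' hT hG (integrable_ind (μ := μ) (hp i))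
  have h3 : ∫ x, Real.negMulLog ((μ[ind (p ⁻¹' {i}) ∘ T | MeasurableSpace.comap T G]) x) ∂μ =
      ∫ x, (fun y => Real.negMulLog ((μ[ind (p ⁻¹' {i}) | G]) y)) (T x) ∂μ := by
    refine integral_congr_ae ?_
    filter_upwards [h2] with x hx
    rw [hx]; rfl
  rw [h1, h3]
  have h4 := integral_map (μ := μ) (φ := T) hT.measurable.aemeasurable
    (f := fun y => Real.negMulLog ((μ[ind (p ⁻¹' {i}) | G]) y))
    (by rw [hT.map_eq]; exact (integrable_negMulLog_cond hG (hp i)).aestronglyMeasurable)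
  rw [hT.map_eq] at h4
  exact h4.symm

/-- σ-algebra of the coordinates `p ∘ T^i`, `i ≥ n`. -/
def fut {ι : Type*} (T : X → X) (p : X → ι) (n : ℕ) : MeasurableSpace X :=
  ⨆ i : ℕ, sg (fun x => p (T^[i + n] x))

lemma partPast_eq_fut (T : X → X) (p : X → ι) : partPast T p = fut T p 1 := rfl

lemma comap_fut (T : X → X) (p : X → ι) (n m : ℕ) :
    MeasurableSpace.comap (T^[m]) (fut T p n) = fut T p (n + m) := by
  unfold fut
  rw [MeasurableSpace.comap_iSup]
  refine iSup_congr fun i => ?_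
  rw [← sg_comp]
  simp only [← Function.iterate_add_apply, add_assoc]

lemma comap_fut_one (T : X → X) (p : X → ι) (n : ℕ) :
    MeasurableSpace.comap T (fut T p n) = fut T p (n + 1) := comap_fut T p n 1

lemma fut_anti (T : X → X) (p : X → ι) : Antitone (fut T p) := by
  intro n m h
  refine iSup_le fun i => ?_
  obtain ⟨k, rfl⟩ := Nat.exists_eq_add_of_le h
  refine le_trans (le_of_eq ?_) (le_iSup (fun i => sg (fun x => p (T^[i + n] x))) (i + k))
  have : i + (n + k) = i + k + n := by ring
  rw [this]

lemma sg_le_fut (T : X → X) (p : X → ι) {n i : ℕ} (h : n ≤ i) :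
    sg (fun x => p (T^[i] x)) ≤ fut T p n := by
  obtain ⟨k, rfl⟩ := Nat.exists_eq_add_of_le h
  refine le_trans (le_of_eq ?_) (le_iSup (fun i => sg (fun x => p (T^[i + n] x))) k)
  rw [add_comm]

lemma fut_le_iff {T : X → X} {p : X → ι} {n : ℕ} :
    fut T p n ≤ F ↔ ∀ i, n ≤ i → sg (fun x => p (T^[i] x)) ≤ F := by
  constructor
  · intro h i hi; exact (sg_le_fut T p hi).trans h
  · intro h; exact iSup_le fun i => h _ (by omega)

lemma fut_le {T : X → X} (hT : Measurable T) {p : X → ι} (hp : MP p) (n : ℕ) :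
    fut T p n ≤ m0 :=
  fut_le_iff.2 fun i _ => sg_le (MP_comp hp (hT.iterate i))

lemma fut_prod (T : X → X) (p : X → ι) (q : X → κ) (n : ℕ) :
    fut T (fun x => (p x, q x)) n = fut T p n ⊔ fut T q n := by
  unfold fut
  rw [← iSup_sup_eq]
  exact iSup_congr fun i => sg_prod _ _

/-- Block partition `(p, p ∘ T, ..., p ∘ T^(n-1))`. -/
def blk {ι : Type*} (T : X → X) (p : X → ι) (n : ℕ) : X → (Fin n → ι) := fun x i => p (T^[(i : ℕ)] x)

lemma sg_blk (T : X → X) (p : X → ι) (n : ℕ) :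
    sg (blk T p n) = ⨆ i : Fin n, sg (fun x => p (T^[(i : ℕ)] x)) := by
  refine le_antisymm ?_ (iSup_le fun i => sg_fun (blk T p n) (fun f => f i))
  let _ : MeasurableSpace X := ⨆ i : Fin n, sg (fun x => p (T^[(i : ℕ)] x))
  refine sg_le fun f => ?_
  have : blk T p n ⁻¹' {f} = ⋂ i : Fin n, (fun x => p (T^[(i : ℕ)] x)) ⁻¹' {f i} := by
    ext x; simp [blk, funext_iff]
  rw [this]
  exact MeasurableSet.iInter fun i => MP_of_sg_le
    (le_iSup (fun i : Fin n => sg (fun x => p (T^[(i : ℕ)] x))) i) (f i)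

lemma sg_blk_le_iff {T : X → X} {p : X → ι} {n : ℕ} :
    sg (blk T p n) ≤ F ↔ ∀ i, i < n → sg (fun x => p (T^[i] x)) ≤ F := by
  rw [sg_blk, iSup_le_iff]
  exact ⟨fun h i hi => h ⟨i, hi⟩, fun h i => h i i.2⟩

lemma MP_blk {T : X → X} (hT : Measurable T) {p : X → ι} (hp : MP p) (n : ℕ) :
    MP (blk T p n) :=
  MP_of_sg_le (sg_blk_le_iff.2 fun i _ => sg_le (MP_comp hp (hT.iterate i)))

lemma fut_zero_eq (T : X → X) (p : X → ι) (n : ℕ) :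
    fut T p 0 = fut T p n ⊔ sg (blk T p n) := by
  refine le_antisymm (fut_le_iff.2 fun i _ => ?_) (sup_le (fut_anti T p (Nat.zero_le _)) ?_)
  · by_cases h : i < n
    · exact (sg_blk_le_iff.1 le_rfl i h).trans le_sup_right
    · exact (sg_le_fut T p (not_lt.1 h)).trans le_sup_left
  · exact sg_blk_le_iff.2 fun i _ => sg_le_fut T p (Nat.zero_le _)

lemma fut_one_eq (T : X → X) (p : X → ι) (n : ℕ) :
    fut T p 1 = fut T p (n + 1) ⊔ sg (fun x => blk T p n (T x)) := by
  rw [sg_comp, ← comap_fut_one, ← comap_fut_one, fut_zero_eq T p n, MeasurableSpace.comap_sup]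

lemma ent_blk_succ {T : X → X} (hT : Measurable T) (hF : F ≤ m0) {p : X → ι} (hp : MP p)
    (n : ℕ) : condPartEntropy μ F (blk T p (n + 1)) =
      condPartEntropy μ F (fun x => blk T p n (T x)) +
        condPartEntropy μ (F ⊔ sg (fun x => blk T p n (T x))) p := by
  rw [← chain hF hp (MP_comp (MP_blk hT hp n) hT)]
  rw [← entropy_comp_inj (F := F) (fun x => (p x, blk T p n (T x)))
    (fun a => (Fin.cons a.1 a.2 : Fin (n + 1) → ι))]
  · congr 1
    funext x
    funext i
    refine Fin.cases ?_ (fun i => ?_) i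
    · simp [blk]
    · simp [blk]
  · rintro ⟨a, b⟩ ⟨c, d⟩ h
    have := Fin.cons_injective2 h
    exact Prod.ext this.1 this.2

lemma ent_blk_zero (hF : F ≤ m0) (T : X → X) (p : X → ι) :
    condPartEntropy μ F (blk T p 0) = 0 :=
  ent_zero hF (sg_blk_le_iff.2 fun i hi => absurd hi (Nat.not_lt_zero _))

lemma ent_blk_cond {T : X → X} (hT : MeasurePreserving T μ μ) {p : X → ι} {r : X → κ}
    (hp : MP p) (hr : MP r) (n : ℕ) :
    condPartEntropy μ (fut T p n ⊔ fut T r n) (blk T p n) =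
      ∑ j ∈ Finset.range n, condPartEntropy μ (fut T p 1 ⊔ fut T r (j + 1)) p := by
  have hle : ∀ n, fut T p n ⊔ fut T r n ≤ m0 := fun n =>
    sup_le (fut_le hT.measurable hp n) (fut_le hT.measurable hr n)
  induction n with
  | zero => rw [ent_blk_zero (hle 0)]; simp
  | succ n ih =>
    rw [ent_blk_succ hT.measurable (hle _) hp, Finset.sum_range_succ, ← ih, ← comap_fut_one,
      ← comap_fut_one, ← MeasurableSpace.comap_sup,
      ent_comp hT (hle n) (MP_blk hT.measurable hp n)]
    congr 2
    rw [MeasurableSpace.comap_sup, comap_fut_one, comap_fut_one, sup_right_comm,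
      ← fut_one_eq]

lemma ent_blk_past {T : X → X} (hT : MeasurePreserving T μ μ) {p : X → ι} (hp : MP p) (n : ℕ) :
    condPartEntropy μ (fut T p n) (blk T p n) = n * partKS μ T p := by
  have h := ent_blk_cond (μ := μ) hT hp hp n
  rw [sup_idem] at h
  rw [h, Finset.sum_congr rfl (g := fun _ => partKS μ T p)]
  · simp
  · intro j _
    rw [sup_of_le_left (fut_anti T p (by omega))]
    rfl

lemma ent_blk_lower {T : X → X} (hT : MeasurePreserving T μ μ) {p : X → ι} (hp : MP p) (n : ℕ) :
    n * partKS μ T p ≤ condPartEntropy μ ⊥ (blk T p n) := by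
  rw [← ent_blk_past hT hp]
  exact ent_anti bot_le (fut_le hT.measurable hp n) (MP_blk hT.measurable hp n)

lemma ent_blk_tendsto {T : X → X} (hT : MeasurePreserving T μ μ) {p : X → ι} (hp : MP p) :
    Tendsto (fun n : ℕ => (n : ℝ)⁻¹ * condPartEntropy μ ⊥ (blk T p n)) atTop
      (𝓝 (partKS μ T p)) := by
  have hmb : ∀ n, MP (fun x => blk T p n (T x)) := fun n =>
    MP_comp (MP_blk hT.measurable hp n) hT.measurable
  have hs : ∀ n, condPartEntropy μ ⊥ (blk T p n) =
      ∑ j ∈ Finset.range n, condPartEntropy μ (sg (fun x => blk T p j (T x))) p := by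
    intro n
    induction n with
    | zero => rw [ent_blk_zero bot_le]; simp
    | succ n ih =>
      rw [ent_blk_succ hT.measurable bot_le hp, Finset.sum_range_succ, ← ih, bot_sup_eq]
      congr 1
      have := ent_comp hT (G := ⊥) bot_le (MP_blk hT.measurable hp n)
      rwa [MeasurableSpace.comap_bot] at this
  have hmono : Monotone (fun n => sg (fun x => blk T p n (T x))) := by
    intro n m h
    simp only [sg_comp]
    refine MeasurableSpace.comap_mono (sg_blk_le_iff.2 fun i hi => ?_)
    exact sg_blk_le_iff.1 le_rfl i (by omega)
  have hsup : ⨆ n, sg (fun x => blk T p n (T x)) = fut T p 1 := by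
    refine le_antisymm (iSup_le fun n => ?_) (fut_le_iff.2 fun i hi => ?_)
    · rw [fut_one_eq T p n]; exact le_sup_right
    · refine le_trans ?_ (le_iSup _ i)
      obtain ⟨k, rfl⟩ : ∃ k, i = k + 1 := ⟨i - 1, by omega⟩
      have := sg_fun (fun x => blk T p (k + 1) (T x)) (fun f => f (Fin.last k))
      exact this
  have ht := entropy_tendsto (μ := μ) (fun n => sg (fun x => blk T p n (T x))) hmono
    (fun n => sg_le (hmb n)) p hp
  rw [hsup] at ht
  have := ht.cesaro
  simp only [← hs] at this
  exact this

lemma ent_blk_swap {T : X → X} (w : X → ι) (r : X → κ) (n : ℕ) :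
    condPartEntropy μ F (blk T (fun x => (w x, r x)) n) =
        condPartEntropy μ F (fun x => (blk T r n x, blk T w n x)) := by
  rw [← entropy_comp_inj (F := F) (fun x => (blk T r n x, blk T w n x))
    (fun a => (fun i => (a.2 i, a.1 i) : Fin n → ι × κ))]
  · rfl
  · rintro ⟨a, b⟩ ⟨c, d⟩ h
    have h' := fun i => congrFun h i
    simp only [Prod.mk.injEq] at h'
    exact Prod.ext (funext fun i => (h' i).2) (funext fun i => (h' i).1)

/-- Key lemma: the remote future of `r` does not affect the entropy of `w` given its future. -/
lemma key_tendsto {T : X → X} (hT : MeasurePreserving T μ μ) {w : X → ι} {r : X → κ}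
    (hw : MP w) (hr : MP r) :
    Tendsto (fun n => condPartEntropy μ (fut T w 1 ⊔ fut T r (n + 1)) w) atTop
      (𝓝 (condPartEntropy μ (fut T w 1) w)) := by
  have hle : ∀ n m, fut T w n ⊔ fut T r m ≤ m0 := fun n m =>
    sup_le (fut_le hT.measurable hw n) (fut_le hT.measurable hr m)
  set b : ℕ → ℝ := fun n => condPartEntropy μ (fut T w 1 ⊔ fut T r (n + 1)) w with hb
  have hmono : Monotone b := fun n m h =>
    ent_anti (sup_le_sup_left (fut_anti T r (by omega)) _) (hle _ _) hw
  have hbd : ∀ n, b n ≤ partKS μ T w := fun n => ent_anti le_sup_left (hle _ _) hw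
  have hlim := tendsto_atTop_ciSup hmono ⟨_, by rintro _ ⟨n, rfl⟩; exact hbd n⟩
  have hub : ∀ n, b n ≤ ⨆ i, b i := fun n =>
    le_ciSup (f := b) ⟨_, by rintro _ ⟨n, rfl⟩; exact hbd n⟩ n
  have hle2 : (⨆ i, b i) ≤ partKS μ T w := ciSup_le hbd
  set W : X → ι × κ := fun x => (w x, r x) with hWdef
  have hW : MP W := MP_prod hw hr
  have hm := hT.measurable
  have e1 : ∀ n : ℕ, (n : ℝ) * partKS μ T W ≤ n * (⨆ i, b i) +
      (condPartEntropy μ ⊥ (blk T W n) - n * partKS μ T w) := by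
    intro n
    have hbw := MP_blk hm hw n
    have hbr := MP_blk hm hr n
    have h1 := ent_blk_past hT hW n
    rw [hWdef, fut_prod, ent_blk_swap w r, chain (hle n n) hbr hbw, ent_blk_cond hT hw hr] at h1
    have h2 : ∑ j ∈ Finset.range n, condPartEntropy μ (fut T w 1 ⊔ fut T r (j + 1)) w ≤
        n * (⨆ i, b i) := by
      have := Finset.sum_le_card_nsmul (Finset.range n) b (⨆ i, b i) fun j _ => hub j
      simpa using this
    have h3 : condPartEntropy μ (fut T w n ⊔ fut T r n ⊔ sg (blk T w n)) (blk T r n) ≤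
        condPartEntropy μ (⊥ ⊔ sg (blk T w n)) (blk T r n) :=
      ent_anti (sup_le_sup_right bot_le _) (sup_le (hle n n) (sg_le hbw)) hbr
    have h4 := chain (μ := μ) (F := ⊥) bot_le hbr hbw
    rw [← ent_blk_swap w r] at h4
    have h5 := ent_blk_lower hT hw n
    linarith
  have hlimW := ent_blk_tendsto hT hW
  have e2 : partKS μ T W ≤ (⨆ i, b i) + (partKS μ T W - partKS μ T w) := by
    refine ge_of_tendsto ((hlimW.sub_const (partKS μ T w)).const_add (⨆ i, b i)) ?_
    filter_upwards [eventually_gt_atTop 0] with n hn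
    have hn' : (0 : ℝ) < n := by exact_mod_cast hn
    have h := mul_le_mul_of_nonneg_left (e1 n) (inv_nonneg.2 hn'.le)
    have : (n : ℝ)⁻¹ * (n * partKS μ T W) = partKS μ T W := by field_simp
    rw [this] at h
    refine h.trans (le_of_eq ?_)
    field_simp
  have : (⨆ i, b i) = partKS μ T w := le_antisymm hle2 (by linarith)
  rw [this] at hlim
  exact hlim

/-- `h(p) ≤ h(q) + H(p | q)`. -/
lemma ks_le {T : X → X} (hT : MeasurePreserving T μ μ) {p : X → ι} {q : X → κ}
    (hp : MP p) (hq : MP q) :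
    partKS μ T p ≤ partKS μ T q + condPartEntropy μ (sg q) p := by
  have hm := hT.measurable
  have e0 : ∀ n, condPartEntropy μ (sg (blk T q n)) (blk T p n) ≤
      n * condPartEntropy μ (sg q) p := by
    intro n
    induction n with
    | zero => rw [ent_blk_zero (sg_le (MP_blk hm hq 0))]; simp
    | succ n ih =>
      have hbq := sg_le (MP_blk hm hq (n + 1))
      rw [ent_blk_succ hm hbq hp]
      have h1 : condPartEntropy μ (sg (blk T q (n + 1))) (fun x => blk T p n (T x)) ≤
          n * condPartEntropy μ (sg q) p := by
        refine le_trans ?_ ih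
        rw [← ent_comp hT (sg_le (MP_blk hm hq n)) (MP_blk hm hp n)]
        refine ent_anti ?_ hbq (MP_comp (MP_blk hm hp n) hm)
        rw [← sg_comp]
        exact sg_fun (blk T q (n + 1)) (fun f => (fun i : Fin n => f i.succ))
      have h2 : condPartEntropy μ (sg (blk T q (n + 1)) ⊔ sg (fun x => blk T p n (T x))) p ≤
          condPartEntropy μ (sg q) p := by
        refine ent_anti (le_trans ?_ le_sup_left)
          (sup_le hbq (sg_le (MP_comp (MP_blk hm hp n) hm))) hp
        exact sg_blk_le_iff.1 le_rfl 0 (Nat.succ_pos n)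
      push_cast
      linarith
  have e1 : ∀ n : ℕ, (n : ℝ) * partKS μ T p ≤
      condPartEntropy μ ⊥ (blk T q n) + n * condPartEntropy μ (sg q) p := by
    intro n
    have hbp := MP_blk hm hp n
    have hbq := MP_blk hm hq n
    have h1 := ent_blk_lower hT hp n
    have h2 := chain (μ := μ) (F := ⊥) bot_le hbp hbq
    have h3 := chain' (μ := μ) (F := ⊥) bot_le hbp hbq
    have h4 := ent_nonneg (μ := μ) (F := ⊥ ⊔ sg (blk T p n)) (sup_le bot_le (sg_le hbp)) hbq
    rw [bot_sup_eq] at h2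
    have := e0 n
    linarith
  refine ge_of_tendsto ((ent_blk_tendsto hT hq).add_const (condPartEntropy μ (sg q) p)) ?_
  filter_upwards [eventually_gt_atTop 0] with n hn
  have hn' : (0 : ℝ) < n := by exact_mod_cast hn
  have h := mul_le_mul_of_nonneg_left (e1 n) (inv_nonneg.2 hn'.le)
  have : (n : ℝ)⁻¹ * (n * partKS μ T p) = partKS μ T p := by field_simp
  rw [this] at h
  refine h.trans (le_of_eq ?_)
  field_simp

end BHR


namespace BHR

set_option linter.unusedSectionVars false

variable {X : Type*} {F G : MeasurableSpace X} {m0 : MeasurableSpace X} {μ : Measure X}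
  [IsProbabilityMeasure μ]
variable {ι κ τ : Type*} [Fintype ι] [Fintype κ] [Fintype τ]

lemma fut_comp (T : X → X) (p : X → ι) (n m : ℕ) :
    fut T (fun x => p (T^[m] x)) n = fut T p (n + m) := by
  rw [← comap_fut]
  unfold fut
  rw [MeasurableSpace.comap_iSup]
  refine iSup_congr fun i => ?_
  rw [← sg_comp]
  congr 1; funext x
  simp only [← Function.iterate_add_apply]
  rw [add_comm m]

lemma good_tendsto {T : X → X} (hT : MeasurePreserving T μ μ) {q : X → ι} {w : X → κ}
    {r : X → τ} (hq : MP q) (hw : MP w) (hr : MP r) (m : ℕ) :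
    Tendsto (fun n => condPartEntropy μ (fut T q 1 ⊔ MeasurableSpace.comap (T^[m])
      (fut T w 1 ⊔ fut T r (n + 1))) q) atTop
      (𝓝 (condPartEntropy μ (fut T q 1 ⊔ MeasurableSpace.comap (T^[m]) (fut T w 1)) q)) := by
  have hm := hT.measurable
  have hW : MP (fun x => (q x, w (T^[m] x))) := MP_prod hq (MP_comp hw (hm.iterate m))
  have hr' : MP (fun x => r (T^[m] x)) := MP_comp hr (hm.iterate m)
  have h := key_tendsto hT hW hr'
  have e1 : fut T (fun x => (q x, w (T^[m] x))) 1 =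
      fut T q 1 ⊔ MeasurableSpace.comap (T^[m]) (fut T w 1) := by
    rw [fut_prod, fut_comp, comap_fut]
  have e2 : ∀ n, fut T q 1 ⊔ MeasurableSpace.comap (T^[m]) (fut T w 1 ⊔ fut T r (n + 1)) =
      fut T (fun x => (q x, w (T^[m] x))) 1 ⊔ fut T (fun x => r (T^[m] x)) (n + 1) := by
    intro n
    rw [e1, MeasurableSpace.comap_sup, fut_comp T r, comap_fut, comap_fut, sup_assoc]
  simp only [e2]
  rw [← e1]
  have hle : ∀ n, fut T (fun x => (q x, w (T^[m] x))) 1 ⊔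
      fut T (fun x => r (T^[m] x)) (n + 1) ≤ m0 := fun n =>
    sup_le (fut_le hm hW 1) (fut_le hm hr' _)
  have h2 := (tendsto_const_nhds (x := condPartEntropy μ
    (fut T (fun x => (q x, w (T^[m] x))) 1) q)).sub (h.const_sub (condPartEntropy μ
    (fut T (fun x => (q x, w (T^[m] x))) 1) (fun x => (q x, w (T^[m] x)))))
  rw [sub_self, sub_zero] at h2
  refine tendsto_of_tendsto_of_tendsto_of_le_of_le h2 tendsto_const_nhds (fun n => ?_) fun n =>
    ent_anti le_sup_left (hle n) hq
  have := ent_loss (μ := μ) le_sup_left (hle n) hW (sg_fun (fun x => (q x, w (T^[m] x))) Prod.fst)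
  simp only at this ⊢
  linarith

lemma step {T : X → X} (hT : MeasurePreserving T μ μ) {Q : ℕ → X → ι} {w : X → κ}
    {r : X → τ} (hQ : ∀ j, MP (Q j)) (hw : MP w) (hr : MP r) (N : ℕ) {ε : ℝ} (hε : 0 < ε) :
    ∃ n, ∀ j < N, ∀ m,
      condPartEntropy μ (fut T (Q j) 1 ⊔ MeasurableSpace.comap (T^[m]) (fut T w 1)) (Q j) - ε ≤
      condPartEntropy μ (fut T (Q j) 1 ⊔ MeasurableSpace.comap (T^[m])
      (fut T w 1 ⊔ fut T r (n + 1))) (Q j) := by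
  have hm := hT.measurable
  have key : ∀ j, ∀ᶠ n in atTop, ∀ m,
      condPartEntropy μ (fut T (Q j) 1 ⊔ MeasurableSpace.comap (T^[m]) (fut T w 1)) (Q j) - ε ≤
      condPartEntropy μ (fut T (Q j) 1 ⊔ MeasurableSpace.comap (T^[m])
      (fut T w 1 ⊔ fut T r (n + 1))) (Q j) := by
    intro j
    have h1 := (key_tendsto hT (hQ j) (MP_prod hw hr)).eventually_const_le
      (sub_lt_self _ hε)
    obtain ⟨M, hM⟩ := eventually_atTop.1 h1
    have h2 : ∀ m ∈ Finset.range M, ∀ᶠ n in atTop,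
      condPartEntropy μ (fut T (Q j) 1 ⊔ MeasurableSpace.comap (T^[m]) (fut T w 1)) (Q j) - ε ≤
      condPartEntropy μ (fut T (Q j) 1 ⊔ MeasurableSpace.comap (T^[m])
      (fut T w 1 ⊔ fut T r (n + 1))) (Q j) := fun m _ =>
      (good_tendsto hT (hQ j) hw hr m).eventually_const_le (sub_lt_self _ hε)
    filter_upwards [(Finset.eventually_all (Finset.range M)).2 h2] with n hn m
    by_cases hmM : m < M
    · exact hn m (Finset.mem_range.2 hmM)
    · have h3 := hM m (not_lt.1 hmM)
      have h4 : condPartEntropy μ (fut T (Q j) 1 ⊔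
          MeasurableSpace.comap (T^[m]) (fut T w 1)) (Q j) ≤
          condPartEntropy μ (fut T (Q j) 1) (Q j) :=
        ent_anti le_sup_left (by
          rw [comap_fut]
          exact sup_le (fut_le hm (hQ j) _) (fut_le hm hw _)) (hQ j)
      have h5 : condPartEntropy μ (fut T (Q j) 1 ⊔ fut T (fun x => (w x, r x)) (m + 1)) (Q j) ≤
          condPartEntropy μ (fut T (Q j) 1 ⊔ MeasurableSpace.comap (T^[m])
            (fut T w 1 ⊔ fut T r (n + 1))) (Q j) := by
        refine ent_anti (sup_le_sup_left ?_ _) (sup_le (fut_le hm (hQ j) _)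
          (fut_le hm (MP_prod hw hr) _)) (hQ j)
        rw [fut_prod, MeasurableSpace.comap_sup, comap_fut, comap_fut]
        exact sup_le_sup (fut_anti T w (by omega)) (fut_anti T r (by omega))
      linarith
  have := (Finset.eventually_all (l := atTop) (p := fun j n => ∀ m,
      condPartEntropy μ (fut T (Q j) 1 ⊔ MeasurableSpace.comap (T^[m]) (fut T w 1)) (Q j) - ε ≤
      condPartEntropy μ (fut T (Q j) 1 ⊔ MeasurableSpace.comap (T^[m])
      (fut T w 1 ⊔ fut T r (n + 1))) (Q j)) (Finset.range N)).2 fun j _ => key j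
  obtain ⟨n, hn⟩ := this.exists
  exact ⟨n, fun j hj => hn j (Finset.mem_range.2 hj)⟩

/-- A finite measurable partition, bundled. -/
structure St (X : Type*) [MeasurableSpace X] where
  ι : Type
  inst : Fintype ι
  w : X → ι
  hw : MP w

attribute [instance] St.inst

lemma exists_seq {T : X → X} (hT : MeasurePreserving T μ μ) {Q : ℕ → X → ι}
    (hQ : ∀ j, MP (Q j)) {c : ℕ → ℕ} (R : ∀ k, X → Fin (c k)) (hR : ∀ k, MP (R k)) :
    ∃ n : ℕ → ℕ, ∀ j, ∀ ε : ℝ, 0 < ε → ∃ m,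
      condPartEntropy μ (fut T (Q j) 1) (Q j) - ε ≤
      condPartEntropy μ (fut T (Q j) 1 ⊔ MeasurableSpace.comap (T^[m])
        (⨆ k, fut T (R k) (n k + 1))) (Q j) := by
  have hm := hT.measurable
  have hst : ∀ (k : ℕ) (s : St X), ∃ n, ∀ j < k + 1, ∀ m,
      condPartEntropy μ (fut T (Q j) 1 ⊔ MeasurableSpace.comap (T^[m]) (fut T s.w 1)) (Q j)
        - (1/2 : ℝ) ^ k ≤
      condPartEntropy μ (fut T (Q j) 1 ⊔ MeasurableSpace.comap (T^[m])
      (fut T s.w 1 ⊔ fut T (R k) (n + 1))) (Q j) := fun k s =>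
    step hT hQ s.hw (hR k) (k + 1) (by positivity)
  choose nn hnn using hst
  let s0 : St X := ⟨Unit, inferInstance, fun _ => (), by
    intro i; have : (fun _ : X => ()) ⁻¹' {i} = univ := by ext; simp
    rw [this]; exact MeasurableSet.univ⟩
  let next : ℕ → St X → St X := fun k s =>
    ⟨s.ι × Fin (c k), inferInstance, fun x => (s.w x, R k (T^[nn k s] x)),
      MP_prod s.hw (MP_comp (hR k) (hm.iterate _))⟩
  have hnext : ∀ k (s : St X), fut T (next k s).w 1 = fut T s.w 1 ⊔ fut T (R k) (nn k s + 1) := by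
    intro k s
    have := fut_prod T s.w (fun x => R k (T^[nn k s] x)) 1
    rw [fut_comp, add_comm 1] at this
    exact this
  have hs0 : fut T s0.w 1 ≤ ⊥ := by
    refine fut_le_iff.2 fun i _ => ?_
    rintro s ⟨B, -, rfl⟩
    by_cases hB : () ∈ B
    · have : (fun x => s0.w (T^[i] x)) ⁻¹' B = univ := by
        ext x; simpa [s0] using hB
      rw [this]; exact @MeasurableSet.univ _ ⊥
    · have : (fun x => s0.w (T^[i] x)) ⁻¹' B = ∅ := by
        ext x; simpa [s0] using hB
      rw [this]; exact @MeasurableSet.empty _ ⊥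
  obtain ⟨S, hS0, hS⟩ : ∃ S : ℕ → St X, fut T (S 0).w 1 ≤ ⊥ ∧ ∀ k, fut T (S (k+1)).w 1 =
      fut T (S k).w 1 ⊔ fut T (R k) (nn k (S k) + 1) :=
    ⟨fun k => Nat.rec s0 next k, hs0, fun k => hnext k _⟩
  obtain ⟨n, hn⟩ : ∃ n : ℕ → ℕ, ∀ k, n k = nn k (S k) := ⟨_, fun _ => rfl⟩
  simp only [← hn] at hS
  have hmono : Monotone (fun k => fut T (S k).w 1) := monotone_nat_of_le_succ fun k => by
    rw [hS]; exact le_sup_left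
  have hsup : ⨆ k, fut T (S k).w 1 = ⨆ k, fut T (R k) (n k + 1) := by
    refine le_antisymm (iSup_le fun k => ?_) (iSup_le fun k => ?_)
    · induction k with
      | zero => exact hS0.trans bot_le
      | succ k ih =>
        rw [hS]; exact sup_le ih (le_iSup (fun k => fut T (R k) (n k + 1)) k)
    · refine le_trans ?_ (le_iSup _ (k + 1))
      rw [hS]; exact le_sup_right
  refine ⟨n, fun j ε hε => ?_⟩
  obtain ⟨k0, hk0, hk0'⟩ : ∃ k0, j ≤ k0 ∧ 2 * (1/2 : ℝ) ^ k0 < ε / 2 := by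
    have h1 : Tendsto (fun k : ℕ => 2 * (1/2 : ℝ) ^ k) atTop (𝓝 0) := by
      simpa using (tendsto_pow_atTop_nhds_zero_of_lt_one (r := (1/2 : ℝ)) (by norm_num)
        (by norm_num)).const_mul 2
    obtain ⟨k0, h⟩ := ((h1.eventually_lt_const (half_pos hε)).and (eventually_ge_atTop j)).exists
    exact ⟨k0, h.2, h.1⟩
  obtain ⟨m, hmm⟩ := ((key_tendsto hT (hQ j) (S k0).hw).eventually_const_le
      (sub_lt_self _ (half_pos hε))).exists
  refine ⟨m, ?_⟩
  rw [← hsup, MeasurableSpace.comap_iSup, sup_iSup]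
  have hle : ∀ k, fut T (Q j) 1 ⊔ MeasurableSpace.comap (T^[m]) (fut T (S k).w 1) ≤ m0 := by
    intro k
    rw [comap_fut]
    exact sup_le (fut_le hm (hQ j) _) (fut_le hm (S k).hw _)
  have ht := entropy_tendsto (μ := μ)
    (fun k => fut T (Q j) 1 ⊔ MeasurableSpace.comap (T^[m]) (fut T (S k).w 1))
    (fun a b h => sup_le_sup_left (MeasurableSpace.comap_mono (hmono h)) _) hle (Q j) (hQ j)
  refine ge_of_tendsto ht ?_
  have hb : ∀ i, condPartEntropy μ (fut T (Q j) 1 ⊔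
        MeasurableSpace.comap (T^[m]) (fut T (S k0).w 1)) (Q j) -
        (2 * (1/2 : ℝ) ^ k0 - 2 * (1/2 : ℝ) ^ (k0 + i)) ≤
      condPartEntropy μ (fut T (Q j) 1 ⊔
        MeasurableSpace.comap (T^[m]) (fut T (S (k0 + i)).w 1)) (Q j) := by
    intro i
    induction i with
    | zero => simp
    | succ i ih =>
      have h := hnn (k0 + i) (S (k0 + i)) j (by omega) m
      rw [← hn, ← hS] at h
      rw [← add_assoc, pow_succ]
      linarith
  filter_upwards [eventually_ge_atTop k0] with k hk
  obtain ⟨i, rfl⟩ := Nat.exists_eq_add_of_le hk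
  have h1 := hb i
  rw [comap_fut, add_comm 1 m] at h1
  have : (0:ℝ) ≤ 2 * (1/2 : ℝ) ^ (k0 + i) := by positivity
  linarith

/-- The two-set partition `(A, Aᶜ)`. -/
noncomputable def ptn (A : Set X) : X → Fin 2 := fun z => if z ∈ A then (0 : Fin 2) else 1

lemma ptn_pre0 (A : Set X) : ptn A ⁻¹' {0} = A := by ext x; by_cases h : x ∈ A <;> simp [ptn, h]

lemma ptn_pre1 (A : Set X) : ptn A ⁻¹' {1} = Aᶜ := by ext x; by_cases h : x ∈ A <;> simp [ptn, h]

lemma MP_ptn {A : Set X} (hA : MeasurableSet A) : MP (ptn A) := by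
  intro i
  fin_cases i
  · simp only [Fin.zero_eta, ptn_pre0]; exact hA
  · simp only [Fin.mk_one, ptn_pre1]; exact hA.compl

lemma sg_ptn_le {A : Set X} (hA : MeasurableSet A) : sg (ptn A) ≤ m0 := sg_le (MP_ptn hA)

lemma mem_sg_ptn (A : Set X) : MeasurableSet[sg (ptn A)] A := ⟨{0}, trivial, ptn_pre0 A⟩

lemma ent_ptn_symmDiff {A B : Set X} (hA : MeasurableSet A) (hB : MeasurableSet B) :
    condPartEntropy μ (sg (ptn B)) (ptn A) ≤
      Real.negMulLog (μ.real (A ∆ B)) + Real.negMulLog (1 - μ.real (A ∆ B)) := by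
  have hAB := hA.symmDiff hB
  have h1 : condPartEntropy μ (sg (ptn B)) (ptn A) ≤
      condPartEntropy μ (sg (ptn B)) (ptn (A ∆ B)) := by
    refine ent_mono (sg_ptn_le hB) (MP_ptn hAB) (sg_ptn_le ?_)
    have h3 := (le_sup_right (a := sg (ptn B)) (b := sg (ptn (A ∆ B)))) _ (mem_sg_ptn (A ∆ B))
    have h4 := (le_sup_left (a := sg (ptn B)) (b := sg (ptn (A ∆ B)))) _ (mem_sg_ptn B)
    have h5 := MeasurableSet.symmDiff h3 h4
    rwa [symmDiff_symmDiff_cancel_right] at h5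
  refine (h1.trans (ent_anti bot_le (sg_ptn_le hB) (MP_ptn hAB))).trans (le_of_eq ?_)
  have hi : ∀ s : Set X, MeasurableSet s → ∫ x, ind s x ∂μ = μ.real s := by
    intro s hs; exact integral_indicator_one hs
  rw [condPartEntropy_def']
  simp only [Fin.sum_univ_two, ptn_pre0, ptn_pre1, condExp_bot, hi _ hAB, hi _ hAB.compl,
    integral_const, probReal_univ, one_smul, probReal_compl_eq_one_sub hAB]

lemma exists_small {ε : ℝ} (hε : 0 < ε) : ∃ η : ℝ, 0 < η ∧ ∀ t : ℝ, 0 ≤ t → t < η →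
    Real.negMulLog t + Real.negMulLog (1 - t) < ε := by
  have hc : Continuous fun t : ℝ => Real.negMulLog t + Real.negMulLog (1 - t) := by
    have := Real.continuous_negMulLog
    fun_prop
  have h := (hc.tendsto 0).eventually_lt_const (u := ε) (by simpa using hε)
  obtain ⟨η, hη, h'⟩ := Metric.eventually_nhds_iff.1 h
  exact ⟨η, hη, fun t h0 h1 => h' (by simpa [abs_of_nonneg h0] using h1)⟩

/-- Existence of the σ-algebra `F`: tail sets have zero entropy. -/
lemma exists_alg [MeasurableSpace.CountablyGenerated X] {T : X → X}
    (hT : MeasurePreserving T μ μ) {c : ℕ → ℕ} (R : ∀ k, X → Fin (c k)) (hR : ∀ k, MP (R k)) :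
    ∃ n : ℕ → ℕ, ∀ A : Set X, (∀ m, MeasurableSet[MeasurableSpace.comap (T^[m])
      (⨆ k, fut T (R k) (n k + 1))] A) → partKS μ T (ptn A) = 0 := by
  have hm := hT.measurable
  have hsep : ∃ D : ℕ → Set X, (∀ j, MeasurableSet (D j)) ∧ ∀ A, MeasurableSet A → ∀ η : ℝ, 0 < η →
      ∃ j, μ.real (A ∆ D j) < η := by
    obtain ⟨𝒜, hc, hd⟩ := exists_countable_measureDense (μ := μ)
    have hne : 𝒜.Nonempty := hd.nonempty
    obtain ⟨D, hD⟩ := hc.exists_eq_range hne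
    refine ⟨D, fun j => hd.measurable _ (hD ▸ mem_range_self j), fun A hA η hη => ?_⟩
    obtain ⟨t, ht, h⟩ := hd.approx A hA (measure_ne_top _ _) η hη
    rw [hD] at ht
    obtain ⟨j, rfl⟩ := ht
    refine ⟨j, ?_⟩
    rw [measureReal_def]
    exact (ENNReal.toReal_lt_of_lt_ofReal h)
  obtain ⟨D, hDm, hD⟩ := hsep
  obtain ⟨n, hn⟩ := exists_seq (μ := μ) hT (Q := fun j => ptn (D j)) (fun j => MP_ptn (hDm j)) R hR
  refine ⟨n, fun A hA => ?_⟩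
  have hFle : ⨆ k, fut T (R k) (n k + 1) ≤ m0 := iSup_le fun k => fut_le hm (hR k) _
  have hFm : ∀ m, MeasurableSpace.comap (T^[m]) (⨆ k, fut T (R k) (n k + 1)) ≤ m0 := fun m =>
    (MeasurableSpace.comap_mono hFle).trans (hm.iterate m).comap_le
  have hA0 : MeasurableSet A := hFm 0 _ (hA 0)
  refine le_antisymm (le_of_forall_pos_le_add fun ε hε => ?_)
    (ent_nonneg (fut_le hm (MP_ptn hA0) 1) (MP_ptn hA0))
  obtain ⟨η, hη, hs⟩ := exists_small (ε := ε / 3) (by positivity)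
  obtain ⟨j, hj⟩ := hD A hA0 η hη
  obtain ⟨m, hmm⟩ := hn j (ε / 3) (by positivity)
  have h1 := ent_ptn_symmDiff (μ := μ) hA0 (hDm j)
  have h2 := ent_ptn_symmDiff (μ := μ) (hDm j) hA0
  have h3 := hs _ measureReal_nonneg hj
  rw [symmDiff_comm] at h2
  have h4 := ks_le hT (MP_ptn hA0) (MP_ptn (hDm j))
  have h5 : condPartEntropy μ (fut T (ptn (D j)) 1 ⊔ MeasurableSpace.comap (T^[m])
        (⨆ k, fut T (R k) (n k + 1))) (ptn (D j)) ≤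
        condPartEntropy μ (sg (ptn A)) (ptn (D j)) :=
    ent_anti (le_trans (sg_ptn_le (hA m)) le_sup_right)
      (sup_le (fut_le hm (MP_ptn (hDm j)) 1) (hFm m)) (MP_ptn (hDm j))
  have h6 : partKS μ T (ptn (D j)) = condPartEntropy μ (fut T (ptn (D j)) 1) (ptn (D j)) := rfl
  linarith

end BHR


namespace BHR

set_option linter.unusedSectionVars false

section part
variable {X : Type*} [MetricSpace X] [CompactSpace X] [MeasurableSpace X] [BorelSpace X]

lemma exists_part [Nonempty X] {ε : ℝ} (hε : 0 < ε) :
    ∃ (c : ℕ) (R : X → Fin c), MP R ∧ ∀ x y, R x = R y → dist x y < ε := by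
  let e := TopologicalSpace.denseSeq X
  obtain ⟨N, hN⟩ : ∃ N : ℕ, ∀ x, ∃ k ≤ N, dist (e k) x < ε / 2 := by
    have hc : (univ : Set X) ⊆ ⋃ k, Metric.ball (e k) (ε / 2) := by
      intro x _
      obtain ⟨k, hk⟩ := (TopologicalSpace.denseRange_denseSeq X).exists_dist_lt x (half_pos hε)
      exact mem_iUnion.2 ⟨k, by simpa using hk⟩
    obtain ⟨t, ht⟩ := isCompact_univ.elim_finite_subcover _ (fun k => Metric.isOpen_ball) hc
    refine ⟨t.sup id, fun x => ?_⟩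
    obtain ⟨k, hk, hx⟩ := mem_iUnion₂.1 (ht (mem_univ x))
    exact ⟨k, Finset.le_sup (f := id) hk, by simpa [dist_comm] using hx⟩
  have hmeas := (SimpleFunc.nearestPtInd e N).measurable
  have hd : ∀ x, dist (SimpleFunc.nearestPt e N x) x < ε / 2 := by
    intro x
    obtain ⟨k, hk, hx⟩ := hN x
    have h1 := SimpleFunc.edist_nearestPt_le e x hk
    rw [edist_dist, edist_dist] at h1
    exact lt_of_le_of_lt ((ENNReal.ofReal_le_ofReal_iff dist_nonneg).1 h1) hx
  refine ⟨N + 1, fun x => ⟨SimpleFunc.nearestPtInd e N x,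
    Nat.lt_succ_of_le (SimpleFunc.nearestPtInd_le e N x)⟩, fun i => ?_, fun x y h => ?_⟩
  · have : (fun x => (⟨SimpleFunc.nearestPtInd e N x,
      Nat.lt_succ_of_le (SimpleFunc.nearestPtInd_le e N x)⟩ : Fin (N + 1))) ⁻¹' {i} =
        (SimpleFunc.nearestPtInd e N) ⁻¹' {(i : ℕ)} := by
      ext x; simp [Fin.ext_iff]
    rw [this]
    exact hmeas (measurableSet_singleton _)
  · have h1 : SimpleFunc.nearestPtInd e N x = SimpleFunc.nearestPtInd e N y :=
      congrArg Fin.val h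
    have h2 : SimpleFunc.nearestPt e N x = SimpleFunc.nearestPt e N y := by
      simp [SimpleFunc.nearestPt, h1]
    have h3 := dist_triangle_left x y (SimpleFunc.nearestPt e N x)
    have h4 := hd x
    have h5 := hd y
    rw [← h2] at h5
    linarith

end part

section gen
variable {X : Type*} {F G : MeasurableSpace X} {m0 : MeasurableSpace X} {μ : Measure X}
  [IsProbabilityMeasure μ]
variable {ι κ τ : Type*} [Fintype ι] [Fintype κ] [Fintype τ]

lemma ks_prod {T : X → X} (hT : Measurable T) {p : X → ι} {q : X → κ} (hp : MP p) (hq : MP q) :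
    partKS μ T (fun x => (p x, q x)) ≤ partKS μ T p + partKS μ T q := by
  have hle := fut_le hT (MP_prod hp hq) 1
  refine (ent_sub hle hp hq).trans (add_le_add (ent_anti ?_ hle hp) (ent_anti ?_ hle hq))
  · change fut T p 1 ≤ _
    rw [fut_prod]; exact le_sup_left
  · change fut T q 1 ≤ _
    rw [fut_prod]; exact le_sup_right

lemma ks_eq_zero_of_gen {T : X → X} (hT : MeasurePreserving T μ μ) {A : ℕ → Set X}
    (hA : ∀ i, MeasurableSet (A i)) (h0 : ∀ i, partKS μ T (ptn (A i)) ≤ 0)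
    (hgen : m0 ≤ ⨆ i, sg (ptn (A i))) {p : X → ι} (hp : MP p) : partKS μ T p ≤ 0 := by
  have hm := hT.measurable
  let s0 : St X := ⟨Fin 2, inferInstance, ptn (A 0), MP_ptn (hA 0)⟩
  let next : ℕ → St X → St X := fun k s =>
    ⟨s.ι × Fin 2, inferInstance, fun x => (s.w x, ptn (A k) x), MP_prod s.hw (MP_ptn (hA k))⟩
  obtain ⟨S, hS0, hS, hK⟩ : ∃ S : ℕ → St X, partKS μ T (S 0).w ≤ 0 ∧
      (∀ k, sg (S (k+1)).w = sg (S k).w ⊔ sg (ptn (A k))) ∧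
      (∀ k, partKS μ T (S (k+1)).w ≤ partKS μ T (S k).w + partKS μ T (ptn (A k))) :=
    ⟨fun k => Nat.rec s0 next k, h0 0, fun k => sg_prod _ _, fun k =>
      ks_prod hm (Nat.rec s0 next k : St X).hw (MP_ptn (hA k))⟩
  have hK0 : ∀ k, partKS μ T (S k).w ≤ 0 := by
    intro k
    induction k with
    | zero => exact hS0
    | succ k ih => linarith [hK k, h0 k]
  have hmono : Monotone (fun k => sg (S k).w) := monotone_nat_of_le_succ fun k => by
    rw [hS]; exact le_sup_left
  have hsup : ⨆ k, sg (S k).w = m0 := by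
    refine le_antisymm (iSup_le fun k => sg_le (S k).hw) (hgen.trans (iSup_le fun k => ?_))
    refine le_trans ?_ (le_iSup _ (k + 1))
    rw [hS]; exact le_sup_right
  have ht := entropy_tendsto (μ := μ) (fun k => sg (S k).w) hmono (fun k => sg_le (S k).hw) p hp
  rw [hsup, ent_zero le_rfl (sg_le hp)] at ht
  refine ge_of_tendsto ht (Eventually.of_forall fun k => ?_)
  linarith [ks_le hT hp (S k).hw, hK0 k]

end gen

section main
variable {X : Type*} [MetricSpace X] [CompactSpace X] [MeasurableSpace X] [BorelSpace X]
  {μ : Measure X} [IsProbabilityMeasure μ]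

lemma exists_entropyPair {T : X → X} (hT : MeasurePreserving T μ μ) (hpos : 0 < ksEntropy μ T) :
    ∃ x y, IsMuEntropyPair T μ x y := by
  by_contra! hno
  have h1 : ∀ z ∈ {z : X × X | z.1 ≠ z.2}, ∃ A : Set X, MeasurableSet A ∧ z.1 ∈ interior A ∧
      z.2 ∈ interior Aᶜ ∧ partKS μ T (ptn A) ≤ 0 := by
    rintro ⟨x, y⟩ hxy
    have := hno x y
    unfold IsMuEntropyPair at this
    push Not at this
    obtain ⟨A, hA, h1, h2, h3⟩ := this hxy
    exact ⟨A, hA, h1, h2, h3⟩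
  choose! A hA hA1 hA2 hA3 using h1
  obtain ⟨t, hts, htc, htcov⟩ := TopologicalSpace.countable_cover_nhdsWithin
    (s := {z : X × X | z.1 ≠ z.2}) (f := fun z => interior (A z) ×ˢ interior (A z)ᶜ)
    (fun z hz => mem_nhdsWithin_of_mem_nhds
      ((isOpen_interior.prod isOpen_interior).mem_nhds ⟨hA1 z hz, hA2 z hz⟩))
  obtain ⟨B, hB⟩ := ((htc.image A).insert univ).exists_eq_range (insert_nonempty _ _)
  have hBm : ∀ i, MeasurableSet (B i) ∧ partKS μ T (ptn (B i)) ≤ 0 := by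
    intro i
    have : B i ∈ insert univ (A '' t) := hB ▸ mem_range_self i
    rcases this with h | ⟨z, hz, h⟩
    · rw [h]
      refine ⟨MeasurableSet.univ, le_of_eq (ent_zero (fut_le hT.measurable
        (MP_ptn MeasurableSet.univ) 1) ?_)⟩
      exact sg_ptn_le (m0 := partPast T (ptn univ)) (@MeasurableSet.univ _ (partPast T (ptn univ)))
    · rw [← h]; exact ⟨hA z (hts hz), hA3 z (hts hz)⟩
  have hsep : ∀ x y, x ≠ y → ∃ i, x ∈ B i ∧ y ∉ B i := by
    intro x y hxy
    obtain ⟨z, hz, hz'⟩ := mem_iUnion₂.1 (htcov (show (x, y) ∈ {z : X × X | z.1 ≠ z.2} from hxy))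
    obtain ⟨i, hi⟩ : A z ∈ range B := hB ▸ Or.inr ⟨z, hz, rfl⟩
    refine ⟨i, ?_, ?_⟩
    · rw [hi]; exact interior_subset hz'.1
    · rw [hi]; exact interior_subset hz'.2
  let f : X → ℕ → Fin 2 := fun x i => ptn (B i) x
  have hfi : ∀ i, Measurable (fun x => ptn (B i) x) := fun i =>
    (measurable_to_countable' (MP_ptn (hBm i).1))
  have hf : Measurable f := measurable_pi_lambda _ hfi
  have hinj : Function.Injective f := by
    intro x y h
    by_contra hxy
    obtain ⟨i, hi, hi'⟩ := hsep x y hxy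
    have := congrFun h i
    simp [f, ptn, hi, hi'] at this
  have hemb : MeasurableEmbedding f := hf.measurableEmbedding hinj
  have hgen : (inferInstance : MeasurableSpace X) ≤ ⨆ i, sg (ptn (B i)) := by
    rw [← hemb.comap_eq]
    change MeasurableSpace.comap f (⨆ i, MeasurableSpace.comap (fun g : ℕ → Fin 2 => g i) ⊤) ≤ _
    rw [MeasurableSpace.comap_iSup]
    refine iSup_mono fun i => ?_
    rw [MeasurableSpace.comap_comp]
    exact le_rfl
  refine hpos.ne' ?_
  unfold ksEntropy
  simp only [ENNReal.iSup_eq_zero]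
  intro k p hp
  rw [ENNReal.ofReal_eq_zero]
  exact ks_eq_zero_of_gen hT (fun i => (hBm i).1) (fun i => (hBm i).2) hgen
    fun i => hp (measurableSet_singleton i)

end main

end BHR


namespace BHR

set_option linter.unusedSectionVars false

/-- `ν` is the relatively independent square of `μ` over `F`. -/
def CS {X : Type*} (F : MeasurableSpace X) [m0 : MeasurableSpace X] (μ : Measure X)
    (ν : Measure (X × X)) : Prop :=
  ∀ a b : X → ℝ, Measurable a → Measurable b → (∀ x, |a x| ≤ 1) → (∀ x, |b x| ≤ 1) →
    ∫ p, a p.1 * b p.2 ∂ν = ∫ x, (μ[a|F]) x * (μ[b|F]) x ∂μ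

section cs
variable {X : Type*} {F G : MeasurableSpace X} {m0 : MeasurableSpace X} {μ : Measure X}
  [IsProbabilityMeasure μ]

lemma exists_CS [StandardBorelSpace X] (hF : F ≤ m0) :
    ∃ ν : Measure (X × X), IsProbabilityMeasure ν ∧ CS F μ ν := by
  let κ : ProbabilityTheory.Kernel X X :=
    (ProbabilityTheory.condExpKernel μ F).comap id (measurable_id'' hF)
  have hκ : ProbabilityTheory.IsMarkovKernel κ := by infer_instance
  refine ⟨Measure.bind μ (ProbabilityTheory.Kernel.prod κ κ), inferInstance, ?_⟩
  intro a b ha hb ha1 hb1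
  have hintg : Integrable (fun p : X × X => a p.1 * b p.2)
      (Measure.bind μ (ProbabilityTheory.Kernel.prod κ κ)) := by
    refine integrable_of_bdd ?_ 1 (Eventually.of_forall fun p => ?_)
    · exact ((ha.comp measurable_fst).mul (hb.comp measurable_snd)).aestronglyMeasurable
    · rw [abs_mul]; exact mul_le_one₀ (ha1 _) (abs_nonneg _) (hb1 _)
  rw [Measure.comp_eq_comp_const_apply] at hintg ⊢
  rw [ProbabilityTheory.Kernel.integral_comp hintg, ProbabilityTheory.Kernel.const_apply]
  have hia : Integrable a μ := integrable_of_bdd ha.aestronglyMeasurable 1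
    (Eventually.of_forall ha1)
  have hib : Integrable b μ := integrable_of_bdd hb.aestronglyMeasurable 1
    (Eventually.of_forall hb1)
  refine integral_congr_ae ?_
  filter_upwards [ProbabilityTheory.condExp_ae_eq_integral_condExpKernel hF hia,
    ProbabilityTheory.condExp_ae_eq_integral_condExpKernel hF hib] with x h1 h2
  rw [ProbabilityTheory.Kernel.prod_apply, integral_prod_mul, h1, h2]
  rfl

end cs
end BHR


namespace BHR

set_option linter.unusedSectionVars false

section cs
variable {X : Type*} {F G : MeasurableSpace X} {m0 : MeasurableSpace X} {μ : Measure X}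
  [IsProbabilityMeasure μ] {ν : Measure (X × X)} [IsProbabilityMeasure ν]

lemma ind_abs (A : Set X) (x : X) : |ind A x| ≤ 1 := by
  rw [abs_of_nonneg (ind_nonneg A x)]; exact ind_le_one A x

lemma CS_real (hν : CS F μ ν) {A B : Set X} (hA : MeasurableSet A) (hB : MeasurableSet B) :
    ν.real (A ×ˢ B) = ∫ x, (μ[ind A|F]) x * (μ[ind B|F]) x ∂μ := by
  rw [← hν (ind A) (ind B) (measurable_ind hA) (measurable_ind hB) (ind_abs A) (ind_abs B)]
  have : (fun p : X × X => ind A p.1 * ind B p.2) = (A ×ˢ B).indicator 1 := by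
    ext p
    by_cases h1 : p.1 ∈ A <;> by_cases h2 : p.2 ∈ B <;>
      simp [ind, h1, h2, indicator, mem_prod]
  rw [this, integral_indicator_one (hA.prod hB)]

lemma condExp_one (hF : F ≤ m0) : μ[ind (univ : Set X)|F] = fun _ => 1 := by
  have : ind (univ : Set X) = fun _ => (1 : ℝ) := by ext x; simp [ind]
  rw [this, condExp_const hF]

lemma integral_ind {A : Set X} (hA : MeasurableSet A) : ∫ x, ind A x ∂μ = μ.real A :=
  integral_indicator_one hA

lemma CS_fst (hF : F ≤ m0) (hν : CS F μ ν) : MeasurePreserving Prod.fst ν μ := by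
  refine ⟨measurable_fst, ?_⟩
  ext A hA
  rw [Measure.map_apply measurable_fst hA]
  have h : ν.real (A ×ˢ univ) = μ.real A := by
    rw [CS_real hν hA MeasurableSet.univ, condExp_one hF]
    simp only [mul_one]
    rw [integral_condExp hF, integral_ind hA]
  have e : (Prod.fst ⁻¹' A : Set (X × X)) = A ×ˢ univ := by ext p; simp
  rw [e]
  exact (ENNReal.toReal_eq_toReal_iff' (measure_ne_top _ _) (measure_ne_top _ _)).1 h

lemma CS_snd (hF : F ≤ m0) (hν : CS F μ ν) : MeasurePreserving Prod.snd ν μ := by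
  refine ⟨measurable_snd, ?_⟩
  ext A hA
  rw [Measure.map_apply measurable_snd hA]
  have h : ν.real (univ ×ˢ A) = μ.real A := by
    rw [CS_real hν MeasurableSet.univ hA, condExp_one hF]
    simp only [one_mul]
    rw [integral_condExp hF, integral_ind hA]
  have e : (Prod.snd ⁻¹' A : Set (X × X)) = univ ×ˢ A := by ext p; simp
  rw [e]
  exact (ENNReal.toReal_eq_toReal_iff' (measure_ne_top _ _) (measure_ne_top _ _)).1 h

lemma CS_null (hF : F ≤ m0) (hν : CS F μ ν) {A : Set X} (hA : MeasurableSet[F] A) :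
    ν (A ×ˢ Aᶜ) = 0 := by
  have h : ν.real (A ×ˢ Aᶜ) = 0 := by
    rw [CS_real hν (hF _ hA) (hF _ hA).compl,
      condExp_of_stronglyMeasurable hF (measurable_ind hA).stronglyMeasurable
        (integrable_ind (hF _ hA)),
      condExp_of_stronglyMeasurable hF
        (measurable_ind (@MeasurableSet.compl _ _ F hA)).stronglyMeasurable
        (integrable_ind (hF _ hA).compl)]
    rw [← integral_zero X ℝ (μ := μ)]
    congr 1; ext x
    by_cases hx : x ∈ A <;> simp [ind, hx]
  rwa [measureReal_eq_zero_iff] at h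

lemma CS_iff (hF : F ≤ m0) (hν : CS F μ ν) {A : Set X} (hA : MeasurableSet[F] A) :
    ∀ᵐ p ∂ν, p.1 ∈ A ↔ p.2 ∈ A := by
  have h1 := CS_null hF hν hA
  have h2 := CS_null hF hν (@MeasurableSet.compl _ _ F hA)
  rw [compl_compl] at h2
  have h1' : ∀ᵐ p ∂ν, p ∉ A ×ˢ Aᶜ := measure_eq_zero_iff_ae_notMem.1 h1
  have h2' : ∀ᵐ p ∂ν, p ∉ Aᶜ ×ˢ A := measure_eq_zero_iff_ae_notMem.1 h2
  filter_upwards [h1', h2'] with p hp1 hp2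
  simp only [mem_prod, mem_compl_iff] at hp1 hp2
  tauto

lemma CS_eq (hF : F ≤ m0) (hν : CS F μ ν) {v : X → ℝ} (hv : Measurable[F] v) :
    ∀ᵐ p ∂ν, v p.1 = v p.2 := by
  have h : ∀ q : ℚ, ∀ᵐ p ∂ν, (v p.1 < q ↔ v p.2 < q) := fun q =>
    CS_iff hF hν (A := v ⁻¹' Iio (q : ℝ)) (hv measurableSet_Iio)
  filter_upwards [ae_all_iff.2 h] with p hp
  by_contra hne
  rcases lt_or_gt_of_ne hne with h | h
  · obtain ⟨q, h1, h2⟩ := exists_rat_btwn h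
    exact absurd ((hp q).1 h1) (not_lt.2 h2.le)
  · obtain ⟨q, h1, h2⟩ := exists_rat_btwn h
    exact absurd ((hp q).2 h1) (not_lt.2 h2.le)

/-- Bounded everywhere version of the conditional expectation. -/
lemma exists_clamp (hG : G ≤ m0) {a : X → ℝ} (ha : Measurable a) (ha1 : ∀ x, |a x| ≤ 1) :
    ∃ f : X → ℝ, Measurable[G] f ∧ (∀ x, |f x| ≤ 1) ∧ f =ᵐ[μ] μ[a|G] := by
  have hia : Integrable a μ := integrable_of_bdd ha.aestronglyMeasurable 1
    (Eventually.of_forall ha1)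
  refine ⟨fun x => max (-1) (min 1 ((μ[a|G]) x)), ?_, fun x => ?_, ?_⟩
  · have := (stronglyMeasurable_condExp (μ := μ) (m := G) (f := a)).measurable
    exact measurable_const.max (measurable_const.min this)
  · rw [abs_le]
    exact ⟨le_max_left _ _, max_le (by norm_num) (min_le_left _ _)⟩
  · have h1 : μ[a|G] ≤ᵐ[μ] fun _ => 1 := by
      have := condExp_mono (m := G) hia (integrable_const (1:ℝ))
        (Eventually.of_forall fun x => (abs_le.1 (ha1 x)).2)
      rwa [condExp_const hG] at this
    have h2 : (fun _ => (-1 : ℝ)) ≤ᵐ[μ] μ[a|G] := by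
      have := condExp_mono (m := G) (integrable_const (-1:ℝ)) hia
        (Eventually.of_forall fun x => (abs_le.1 (ha1 x)).1)
      rwa [condExp_const hG] at this
    filter_upwards [h1, h2] with x hx1 hx2
    rw [min_eq_right hx1, max_eq_right hx2]

lemma CS_rect (hF : F ≤ m0) (hν : CS F μ ν) (hFG : F ≤ G) (hG : G ≤ m0) {a b f g : X → ℝ}
    (ha : Measurable a) (hb : Measurable b) (ha1 : ∀ x, |a x| ≤ 1) (hb1 : ∀ x, |b x| ≤ 1)
    (hf : Measurable f) (hg : Measurable g) (hf1 : ∀ x, |f x| ≤ 1) (hg1 : ∀ x, |g x| ≤ 1)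
    (hfa : f =ᵐ[μ] μ[a|G]) (hgb : g =ᵐ[μ] μ[b|G]) {C D : Set X}
    (hC : MeasurableSet[G] C) (hD : MeasurableSet[G] D) :
    ∫ p in C ×ˢ D, f p.1 * g p.2 ∂ν = ∫ p in C ×ˢ D, a p.1 * b p.2 ∂ν := by
  have e : ∀ a b : X → ℝ, ∫ p in C ×ˢ D, a p.1 * b p.2 ∂ν =
      ∫ p, C.indicator a p.1 * D.indicator b p.2 ∂ν := by
    intro a b
    rw [← integral_indicator ((hG _ hC).prod (hG _ hD))]
    congr 1; ext p
    by_cases h1 : p.1 ∈ C <;> by_cases h2 : p.2 ∈ D <;> simp [h1, h2, indicator, mem_prod]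
  have hb' : ∀ {a : X → ℝ} (C : Set X), (∀ x, |a x| ≤ 1) → ∀ x, |C.indicator a x| ≤ 1 := by
    intro a C ha x
    by_cases hx : x ∈ C
    · simpa [hx] using ha x
    · simp [hx]
  have hintg : ∀ {a : X → ℝ}, Measurable a → (∀ x, |a x| ≤ 1) → Integrable a μ := fun ha ha1 =>
    integrable_of_bdd ha.aestronglyMeasurable 1 (Eventually.of_forall ha1)
  have key : ∀ {a f : X → ℝ} {C : Set X}, Measurable a → (∀ x, |a x| ≤ 1) → f =ᵐ[μ] μ[a|G] →
      MeasurableSet[G] C → μ[C.indicator f|F] =ᵐ[μ] μ[C.indicator a|F] := by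
    intro a f C ha ha1 hfa hC
    have h1 : C.indicator f =ᵐ[μ] μ[C.indicator a|G] := by
      filter_upwards [condExp_indicator (hintg ha ha1) hC, hfa] with x h2 h3
      rw [h2]; simp only [indicator, h3]
    exact (condExp_congr_ae h1).trans (condExp_condExp_of_le hFG hG)
  rw [e, e, hν _ _ (hf.indicator (hG _ hC)) (hg.indicator (hG _ hD)) (hb' C hf1) (hb' D hg1),
    hν _ _ (ha.indicator (hG _ hC)) (hb.indicator (hG _ hD)) (hb' C ha1) (hb' D hb1)]
  refine integral_congr_ae ?_
  filter_upwards [key ha ha1 hfa hC, key hb hb1 hgb hD] with x h1 h2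
  rw [h1, h2]

lemma CS_condExp (hF : F ≤ m0) (hν : CS F μ ν) (hFG : F ≤ G) (hG : G ≤ m0) {a b : X → ℝ}
    (ha : Measurable a) (hb : Measurable b) (ha1 : ∀ x, |a x| ≤ 1) (hb1 : ∀ x, |b x| ≤ 1) :
    ν[fun p => a p.1 * b p.2 | MeasurableSpace.prod G G] =ᵐ[ν]
      fun p => (μ[a|G]) p.1 * (μ[b|G]) p.2 := by
  obtain ⟨f, hf, hf1, hfa⟩ := exists_clamp (μ := μ) hG ha ha1
  obtain ⟨g, hg, hg1, hgb⟩ := exists_clamp (μ := μ) hG hb hb1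
  have hf0 : Measurable f := hf.mono hG le_rfl
  have hg0 : Measurable g := hg.mono hG le_rfl
  have hle : MeasurableSpace.prod G G ≤ MeasurableSpace.prod m0 m0 :=
    sup_le_sup (MeasurableSpace.comap_mono hG) (MeasurableSpace.comap_mono hG)
  have hintg : ∀ {a b : X → ℝ}, Measurable a → Measurable b → (∀ x, |a x| ≤ 1) →
      (∀ x, |b x| ≤ 1) → Integrable (fun p : X × X => a p.1 * b p.2) ν := by
    intro a b ha hb ha1 hb1
    refine integrable_of_bdd ?_ 1 (Eventually.of_forall fun p => ?_)
    · exact ((ha.comp measurable_fst).mul (hb.comp measurable_snd)).aestronglyMeasurable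
    · rw [abs_mul]; exact mul_le_one₀ (ha1 _) (abs_nonneg _) (hb1 _)
  have h1 : (fun p : X × X => f p.1 * g p.2) =ᵐ[ν]
      ν[fun p => a p.1 * b p.2 | MeasurableSpace.prod G G] := by
    refine ae_eq_condExp_of_forall_setIntegral_eq hle (hintg ha hb ha1 hb1)
      (fun s _ _ => (hintg hf0 hg0 hf1 hg1).integrableOn) ?_ ?_
    · intro s hs _
      have hrect : ∀ {C D : Set X}, MeasurableSet[G] C → MeasurableSet[G] D →
          ∫ p in C ×ˢ D, f p.1 * g p.2 ∂ν = ∫ p in C ×ˢ D, a p.1 * b p.2 ∂ν := fun hC hD =>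
        CS_rect hF hν hFG hG ha hb ha1 hb1 hf0 hg0 hf1 hg1 hfa hgb hC hD
      have huniv : ∫ p, f p.1 * g p.2 ∂ν = ∫ p, a p.1 * b p.2 ∂ν := by
        have := hrect (@MeasurableSet.univ X G) (@MeasurableSet.univ X G)
        rwa [univ_prod_univ, setIntegral_univ, setIntegral_univ] at this
      refine MeasurableSpace.induction_on_inter (m := MeasurableSpace.prod G G)
        (C := fun s _ => ∫ p in s, f p.1 * g p.2 ∂ν = ∫ p in s, a p.1 * b p.2 ∂ν)
        (@generateFrom_prod X X G G).symm (@isPiSystem_prod X X G G) ?_ ?_ ?_ ?_ s hs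
      · simp
      · rintro _ ⟨C, hC, D, hD, rfl⟩
        exact hrect hC hD
      · intro t ht h
        have i1 := integral_add_compl (hle _ ht) (hintg hf0 hg0 hf1 hg1)
        have i2 := integral_add_compl (hle _ ht) (hintg ha hb ha1 hb1)
        linarith
      · intro t hd ht h
        rw [integral_iUnion (fun i => hle _ (ht i)) hd (hintg hf0 hg0 hf1 hg1).integrableOn,
          integral_iUnion (fun i => hle _ (ht i)) hd (hintg ha hb ha1 hb1).integrableOn]
        exact tsum_congr h
    · refine Measurable.aestronglyMeasurable ?_
      exact (hf.comp (@measurable_fst X X G G)).mul (hg.comp (@measurable_snd X X G G))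
  refine h1.symm.trans ?_
  filter_upwards [(CS_fst hF hν).quasiMeasurePreserving.ae hfa,
    (CS_snd hF hν).quasiMeasurePreserving.ae hgb] with p hp1 hp2
  rw [hp1, hp2]

end cs
end BHR


namespace BHR

set_option linter.unusedSectionVars false

section hilb

lemma hilb_conv {H : Type*} [NormedAddCommGroup H] [InnerProductSpace ℝ H] [CompleteSpace H]
    (x : ℕ → H) (hx : ∀ m l, m ≤ l → inner ℝ (x m) (x l) = inner ℝ (x l) (x l)) :
    ∃ g, Tendsto x atTop (𝓝 g) := by
  have h1 : ∀ m l, m ≤ l → ‖x m - x l‖ ^ 2 = ‖x m‖ ^ 2 - ‖x l‖ ^ 2 := by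
    intro m l hml
    rw [@norm_sub_sq_real, hx m l hml, real_inner_self_eq_norm_sq]; ring
  have hanti : Antitone fun n => ‖x n‖ ^ 2 := by
    intro m l hml
    have := h1 m l hml
    have h0 := sq_nonneg ‖x m - x l‖
    simp only; linarith
  have hbdd : BddBelow (range fun n => ‖x n‖ ^ 2) := ⟨0, by rintro _ ⟨n, rfl⟩; positivity⟩
  have hlim := tendsto_atTop_ciInf hanti hbdd
  have hc := hlim.cauchySeq
  refine cauchySeq_tendsto_of_complete ?_
  rw [Metric.cauchySeq_iff'] at hc ⊢
  intro ε hε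
  obtain ⟨N, hN⟩ := hc (ε ^ 2) (by positivity)
  refine ⟨N, fun n hn => ?_⟩
  have := hN n hn
  rw [dist_comm, Real.dist_eq, abs_lt] at this
  rw [dist_comm, dist_eq_norm]
  have h2 := h1 N n hn
  nlinarith [norm_nonneg (x N - x n)]

end hilb

section tail
variable {X : Type*} {F G : MeasurableSpace X} {Fs : ℕ → MeasurableSpace X}
  {m0 : MeasurableSpace X} {μ : Measure X} [IsProbabilityMeasure μ]

lemma exists_clamp01 (hG : G ≤ m0) {U : Set X} (hU : MeasurableSet U) :
    ∃ f : X → ℝ, Measurable[G] f ∧ (∀ x, 0 ≤ f x ∧ f x ≤ 1) ∧ f =ᵐ[μ] μ[ind U|G] := by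
  refine ⟨fun x => max 0 (min 1 ((μ[ind U|G]) x)), ?_, fun x => ?_, ?_⟩
  · have := (stronglyMeasurable_condExp (μ := μ) (m := G) (f := ind U)).measurable
    exact measurable_const.max (measurable_const.min this)
  · exact ⟨le_max_left _ _, max_le (by norm_num) (min_le_left _ _)⟩
  · filter_upwards [cond_nonneg (F := G) (μ := μ) U, cond_le_one (μ := μ) hG hU] with x hx1 hx2
    rw [min_eq_right hx2, max_eq_right hx1]

lemma tail_lim (hanti : Antitone Fs) (hle : ∀ m, Fs m ≤ m0) {U : Set X} (hU : MeasurableSet U) :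
    ∃ (f : ℕ → X → ℝ) (u : X → ℝ), (∀ m, Measurable[Fs m] (f m)) ∧
      (∀ m x, 0 ≤ f m x ∧ f m x ≤ 1) ∧ (∀ m, f m =ᵐ[μ] μ[ind U|Fs m]) ∧
      (∀ m, Measurable[Fs m] u) ∧ (∀ x, 0 ≤ u x ∧ u x ≤ 1) ∧ TendstoInMeasure μ f atTop u ∧
      ∀ᵐ x ∂μ, x ∈ U → 0 < u x := by
  choose f hf hf01 hfe using fun m => exists_clamp01 (μ := μ) (hle m) hU
  have hf0 : ∀ m, Measurable (f m) := fun m => (hf m).mono (hle m) le_rfl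
  have hintg : ∀ m, Integrable (f m) μ := fun m =>
    integrable_of_bdd (hf0 m).aestronglyMeasurable 1 (Eventually.of_forall fun x => by
      rw [abs_of_nonneg (hf01 m x).1]; exact (hf01 m x).2)
  have hLp : ∀ m, MemLp (f m) 2 μ := fun m =>
    MemLp.of_bound (hf0 m).aestronglyMeasurable 1 (Eventually.of_forall fun x => by
      rw [Real.norm_eq_abs, abs_of_nonneg (hf01 m x).1]; exact (hf01 m x).2)
  have horth : ∀ m l, m ≤ l → ∫ x, f l x * f m x ∂μ = ∫ x, f l x * f l x ∂μ := by
    intro m l hml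
    rw [integral_mul_pull (hle l) (hf l).stronglyMeasurable ?_ (hintg m)]
    · refine integral_congr_ae ?_
      have e1 : μ[f m|Fs l] =ᵐ[μ] f l :=
        (condExp_congr_ae (hfe m)).trans
          ((condExp_condExp_of_le (hanti hml) (hle m)).trans (hfe l).symm)
      filter_upwards [e1] with x hx
      rw [hx]
    · refine integrable_of_bdd ((hf0 l).mul (hf0 m)).aestronglyMeasurable 1
        (Eventually.of_forall fun x => ?_)
      rw [abs_of_nonneg (mul_nonneg (hf01 l x).1 (hf01 m x).1)]
      exact mul_le_one₀ (hf01 l x).2 (hf01 m x).1 (hf01 m x).2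
  obtain ⟨g, hg⟩ := hilb_conv (fun m => (hLp m).toLp (f m)) (by
    intro m l hml
    have e : ∀ m l, inner ℝ ((hLp m).toLp (f m)) ((hLp l).toLp (f l)) =
        ∫ x, f l x * f m x ∂μ := by
      intro m l
      rw [L2.inner_def]
      refine integral_congr_ae ?_
      filter_upwards [(hLp m).coeFn_toLp, (hLp l).coeFn_toLp] with x h1 h2
      rw [h1, h2]; simp
    rw [e, e, horth m l hml])
  have hm1 : TendstoInMeasure μ f atTop g :=
    (tendstoInMeasure_of_tendsto_Lp hg).congr_left fun m => (hLp m).coeFn_toLp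
  obtain ⟨ns, hns, hae⟩ := hm1.exists_seq_tendsto_ae
  set u : X → ℝ := fun x => max 0 (min 1 (limsup (fun i => f (ns i) x) atTop)) with hu
  have hum : ∀ m, Measurable[Fs m] u := by
    intro m
    have e : (fun x => limsup (fun i => f (ns i) x) atTop) =
        fun x => limsup (fun i => f (ns (i + m)) x) atTop := by
      ext x; exact (limsup_nat_add (fun i => f (ns i) x) m).symm
    have h1 : Measurable[Fs m] fun x => limsup (fun i => f (ns i) x) atTop := by
      rw [e]
      refine Measurable.limsup fun i => (hf (ns (i + m))).mono (hanti ?_) le_rfl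
      exact le_trans (Nat.le_add_left m i) (hns.id_le (i + m))
    exact measurable_const.max (measurable_const.min h1)
  have hutend : ∀ᵐ x ∂μ, Tendsto (fun i => f (ns i) x) atTop (𝓝 (u x)) := by
    filter_upwards [hae] with x hx
    have h1 : limsup (fun i => f (ns i) x) atTop = g x := hx.limsup_eq
    have h2 : 0 ≤ g x := ge_of_tendsto' hx fun i => (hf01 _ x).1
    have h3 : g x ≤ 1 := le_of_tendsto' hx fun i => (hf01 _ x).2
    have : u x = g x := by simp only [hu, h1, min_eq_right h3, max_eq_right h2]
    rwa [this]
  have hug : u =ᵐ[μ] g := by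
    filter_upwards [hae, hutend] with x h1 h2 using tendsto_nhds_unique h2 h1
  refine ⟨f, u, hf, hf01, hfe, hum, fun x => ⟨le_max_left _ _, max_le (by norm_num) (min_le_left _ _)⟩,
    hm1.congr_right hug.symm, ?_⟩
  have hu0 : Measurable u := (hum 0).mono (hle 0) le_rfl
  set Z : Set X := {x | u x ≤ 0} with hZ
  have hZm : ∀ m, MeasurableSet[Fs m] Z := fun m => measurableSet_le (hum m) measurable_const
  have hZ0 : MeasurableSet Z := hle 0 _ (hZm 0)
  have e1 : ∀ m, ∫ x in Z, f m x ∂μ = μ.real (U ∩ Z) := by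
    intro m
    rw [setIntegral_congr_ae (g := fun x => (μ[ind U|Fs m]) x) hZ0
      ((hfe m).mono fun x hx _ => hx), setIntegral_condExp (hle m) (integrable_ind hU) (hZm m)]
    unfold ind
    rw [setIntegral_indicator hU, setIntegral_const, inter_comm]; simp
  have e2 : Tendsto (fun i => ∫ x in Z, f (ns i) x ∂μ) atTop (𝓝 (∫ x in Z, u x ∂μ)) := by
    refine tendsto_integral_of_dominated_convergence (fun _ => 1)
      (fun i => (hf0 _).aestronglyMeasurable) (integrable_const _) (fun i => ?_)
      (ae_restrict_of_ae hutend)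
    refine Eventually.of_forall fun x => ?_
    rw [Real.norm_eq_abs, abs_of_nonneg (hf01 _ x).1]; exact (hf01 _ x).2
  have e3 : ∫ x in Z, u x ∂μ = 0 := by
    rw [setIntegral_congr_fun (g := fun _ => (0:ℝ)) hZ0 (fun x hx => le_antisymm hx (le_max_left _ _))]
    simp
  simp only [e1, e3] at e2
  have e4 : μ.real (U ∩ Z) = 0 := tendsto_nhds_unique tendsto_const_nhds e2
  have e5 : μ (U ∩ Z) = 0 := by rwa [measureReal_eq_zero_iff] at e4
  rw [measure_eq_zero_iff_ae_notMem] at e5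
  filter_upwards [e5] with x hx hxU
  by_contra h
  exact hx ⟨hxU, not_lt.1 h⟩

end tail

end BHR


namespace BHR

set_option linter.unusedSectionVars false

section inv
variable {X : Type*} {F : MeasurableSpace X} {m0 : MeasurableSpace X} {μ : Measure X}
  [IsProbabilityMeasure μ] {ν : Measure (X × X)} [IsProbabilityMeasure ν] {T S : X → X}

lemma iter_cancel (hTS : Function.LeftInverse T S) {m n : ℕ} (h : m ≤ n) :
    T^[m] ∘ S^[n] = S^[n - m] := by
  obtain ⟨k, rfl⟩ := Nat.exists_eq_add_of_le h
  rw [Nat.add_sub_cancel_left, Function.iterate_add, ← Function.comp_assoc,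
    (hTS.iterate m).comp_eq_id, Function.id_comp]

lemma comap_iter_cancel (hTS : Function.LeftInverse T S) {m n : ℕ} (h : m ≤ n) :
    MeasurableSpace.comap (S^[n]) (MeasurableSpace.comap (T^[m]) F) =
      MeasurableSpace.comap (S^[n - m]) F := by
  rw [MeasurableSpace.comap_comp, iter_cancel hTS h]

lemma comap_iter_mono (hTS : Function.LeftInverse T S) (hTF : MeasurableSpace.comap T F ≤ F) :
    Monotone fun n => MeasurableSpace.comap (S^[n]) F := by
  refine monotone_nat_of_le_succ fun n => ?_
  have h1 : F ≤ MeasurableSpace.comap S F := by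
    have := MeasurableSpace.comap_mono (g := S) hTF
    rwa [MeasurableSpace.comap_comp, hTS.comp_eq_id, MeasurableSpace.comap_id] at this
  have := MeasurableSpace.comap_mono (g := S^[n]) h1
  rwa [MeasurableSpace.comap_comp, ← Function.iterate_succ'] at this

lemma comap_iter_anti (hTF : MeasurableSpace.comap T F ≤ F) :
    Antitone fun n => MeasurableSpace.comap (T^[n]) F := by
  refine antitone_nat_of_succ_le fun n => ?_
  have := MeasurableSpace.comap_mono (g := T^[n]) hTF
  rwa [MeasurableSpace.comap_comp, ← Function.iterate_succ'] at this

lemma comap_iter_le (hF : F ≤ m0) (hS : Measurable S) (n : ℕ) :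
    MeasurableSpace.comap (S^[n]) F ≤ m0 :=
  (MeasurableSpace.comap_mono hF).trans (hS.iterate n).comap_le

def EE (S : X → X) (U V : Set X) (n : ℕ) : Set (X × X) := {p | S^[n] p.1 ∈ U ∧ S^[n] p.2 ∈ V}

lemma EE_cond (hTS : Function.LeftInverse T S) (hS : MeasurePreserving S μ μ)
    (hT : Measurable T)
    (hF : F ≤ m0) (hTF : MeasurableSpace.comap T F ≤ F) (hν : CS F μ ν) {U V : Set X}
    (hU : MeasurableSet U) (hV : MeasurableSet V) {f g : X → ℝ} {m n : ℕ} (hmn : m ≤ n)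
    (hf : f =ᵐ[μ] μ[ind U|MeasurableSpace.comap (T^[m]) F])
    (hg : g =ᵐ[μ] μ[ind V|MeasurableSpace.comap (T^[m]) F]) :
    ν[(EE S U V n).indicator 1 | MeasurableSpace.prod (MeasurableSpace.comap (S^[n - m]) F)
      (MeasurableSpace.comap (S^[n - m]) F)] =ᵐ[ν] fun p => f (S^[n] p.1) * g (S^[n] p.2) := by
  have hSn := hS.iterate n
  have hFG : F ≤ MeasurableSpace.comap (S^[n - m]) F := by
    have := comap_iter_mono hTS hTF (Nat.zero_le (n - m))
    simpa [MeasurableSpace.comap_id] using this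
  have key : ∀ {U : Set X} {f : X → ℝ}, MeasurableSet U →
      f =ᵐ[μ] μ[ind U|MeasurableSpace.comap (T^[m]) F] →
      μ[ind U ∘ S^[n] | MeasurableSpace.comap (S^[n - m]) F] =ᵐ[μ] f ∘ S^[n] := by
    intro U f hU hf
    have h1 := condExp_comp' hSn (comap_iter_le hF hT m) (integrable_ind (μ := μ) hU)
    rw [comap_iter_cancel hTS hmn] at h1
    exact h1.trans (hSn.quasiMeasurePreserving.ae_eq_comp hf.symm)
  have h2 := CS_condExp hF hν hFG (comap_iter_le hF hS.measurable (n - m))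
    ((measurable_ind hU).comp hSn.measurable) ((measurable_ind hV).comp hSn.measurable)
    (fun x => ind_abs U _) (fun x => ind_abs V _)
  have e : (EE S U V n).indicator 1 =
      fun p : X × X => (ind U ∘ S^[n]) p.1 * (ind V ∘ S^[n]) p.2 := by
    ext p
    by_cases h1 : S^[n] p.1 ∈ U <;> by_cases h2 : S^[n] p.2 ∈ V <;>
      simp [ind, h1, h2, indicator, EE]
  rw [e]
  filter_upwards [h2, (CS_fst hF hν).quasiMeasurePreserving.ae_eq_comp (key hU hf),
    (CS_snd hF hν).quasiMeasurePreserving.ae_eq_comp (key hV hg)] with p h3 h4 h5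
  rw [h3]
  exact congrArg₂ (· * ·) h4 h5

lemma exists_residue {h : ℕ → ℝ} {c : ℝ} {L : ℕ} (hL : 0 < L) (hh : ∃ᶠ n in atTop, c ≤ h n) :
    ∃ r < L, ∃ᶠ j in atTop, c ≤ h (r + j * L) := by
  by_contra hcon
  push Not at hcon
  have h1 : ∀ᶠ j in atTop, ∀ r ∈ Finset.range L, h (r + j * L) < c := by
    rw [Finset.eventually_all]
    intro r hr
    have := hcon r (Finset.mem_range.1 hr)
    simpa using this
  obtain ⟨J, hJ⟩ := eventually_atTop.1 h1
  refine hh ?_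
  refine eventually_atTop.2 ⟨J * L, fun n hn => ?_⟩
  have h2 := hJ (n / L) ((Nat.le_div_iff_mul_le hL).2 hn) (n % L)
    (Finset.mem_range.2 (Nat.mod_lt _ hL))
  rw [Nat.mod_add_div'] at h2
  exact not_le.2 h2

lemma sum_tendsto {h : ℕ → ℝ} (h0 : ∀ n, 0 ≤ h n) {c : ℝ} (hc : 0 < c)
    (hh : ∃ᶠ n in atTop, c ≤ h n) :
    Tendsto (fun n => ∑ k ∈ Finset.range n, h k) atTop atTop := by
  rw [← not_summable_iff_tendsto_nat_atTop_of_nonneg h0]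
  intro hs
  have := hs.tendsto_atTop_zero.eventually (gt_mem_nhds hc)
  exact hh (this.mono fun n hn => not_le.2 hn)

lemma EE_io (hTS : Function.LeftInverse T S) (hS : MeasurePreserving S μ μ)
    (hT : Measurable T)
    (hF : F ≤ m0) (hTF : MeasurableSpace.comap T F ≤ F) (hν : CS F μ ν) {U V : Set X} {K : ℕ}
    (hK : 0 < K)
    (hU : MeasurableSet[MeasurableSpace.comap (S^[K]) F] U)
    (hV : MeasurableSet[MeasurableSpace.comap (S^[K]) F] V) {f g : X → ℝ} {m : ℕ}
    (hf : f =ᵐ[μ] μ[ind U|MeasurableSpace.comap (T^[m]) F])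
    (hg : g =ᵐ[μ] μ[ind V|MeasurableSpace.comap (T^[m]) F])
    (hf0 : ∀ x, 0 ≤ f x) (hg0 : ∀ x, 0 ≤ g x) {c : ℝ} (hc : 0 < c) :
    ∀ᵐ p ∂ν, (∃ᶠ n in atTop, c ≤ f (S^[n] p.1) * g (S^[n] p.2)) →
      ∃ᶠ n in atTop, S^[n] p.1 ∈ U ∧ S^[n] p.2 ∈ V := by
  have hU0 : MeasurableSet U := comap_iter_le hF hS.measurable K _ hU
  have hV0 : MeasurableSet V := comap_iter_le hF hS.measurable K _ hV
  have hGm := comap_iter_mono hTS hTF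
  set L := m + K with hL
  have hLpos : 0 < L := by omega
  have key : ∀ r : ℕ, ∀ᵐ p ∂ν, (∃ᶠ j in atTop, p ∈ EE S U V (r + j * L)) ↔
      Tendsto (fun n => ∑ k ∈ Finset.range n, f (S^[r + (k + 1) * L] p.1) *
        g (S^[r + (k + 1) * L] p.2)) atTop atTop := by
    intro r
    let ℱ : Filtration ℕ (MeasurableSpace.prod m0 m0) :=
      { seq := fun j => MeasurableSpace.prod (MeasurableSpace.comap (S^[r + j * L + K]) F)
          (MeasurableSpace.comap (S^[r + j * L + K]) F)
        mono' := by
          intro i j hij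
          have h1 : r + i * L + K ≤ r + j * L + K := by
            have := Nat.mul_le_mul_right L hij
            omega
          exact sup_le_sup (MeasurableSpace.comap_mono (hGm h1))
            (MeasurableSpace.comap_mono (hGm h1))
        le' := by
          intro i
          exact sup_le_sup (MeasurableSpace.comap_mono (comap_iter_le hF hS.measurable _))
            (MeasurableSpace.comap_mono (comap_iter_le hF hS.measurable _)) }
    have hs : ∀ j, MeasurableSet[ℱ j] (EE S U V (r + j * L)) := by
      intro j
      have e : ∀ {U : Set X}, MeasurableSet[MeasurableSpace.comap (S^[K]) F] U →
          MeasurableSet[MeasurableSpace.comap (S^[r + j * L + K]) F] (S^[r + j * L] ⁻¹' U) := by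
        rintro U ⟨W, hW, rfl⟩
        refine ⟨W, hW, ?_⟩
        rw [← preimage_comp, ← Function.iterate_add, Nat.add_comm K]
      have h1 := (@measurable_fst X X (MeasurableSpace.comap (S^[r + j * L + K]) F)
        (MeasurableSpace.comap (S^[r + j * L + K]) F)) (e hU)
      have h2 := (@measurable_snd X X (MeasurableSpace.comap (S^[r + j * L + K]) F)
        (MeasurableSpace.comap (S^[r + j * L + K]) F)) (e hV)
      exact MeasurableSet.inter h1 h2
    have h1 := ae_mem_limsup_atTop_iff ν hs
    have h2 : ∀ᵐ p ∂ν, ∀ k : ℕ,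
        (ν[(EE S U V (r + (k + 1) * L)).indicator 1 | ℱ k]) p =
        f (S^[r + (k + 1) * L] p.1) * g (S^[r + (k + 1) * L] p.2) := by
      rw [ae_all_iff]
      intro k
      have e1 : m ≤ r + (k + 1) * L := by
        have : (k + 1) * L = k * L + L := by ring
        omega
      have e2 : r + (k + 1) * L - m = r + k * L + K := by
        have : (k + 1) * L = k * L + L := by ring
        omega
      have h3 := EE_cond hTS hS hT hF hTF hν hU0 hV0 e1 hf hg
      rw [e2] at h3
      exact h3
    filter_upwards [h1, h2] with p h3 h4
    rw [mem_limsup_iff_frequently_mem] at h3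
    rw [h3]
    simp only [h4]
  have key' := ae_all_iff.2 key
  filter_upwards [key'] with p hp hfr
  obtain ⟨r, -, hr⟩ := exists_residue hLpos hfr
  have hr2 : ∃ᶠ j in atTop, c ≤ f (S^[r + (j + 1) * L] p.1) * g (S^[r + (j + 1) * L] p.2) := by
    rw [frequently_atTop] at hr ⊢
    intro a
    obtain ⟨b, hb, hb2⟩ := hr (a + 1)
    refine ⟨b - 1, by omega, ?_⟩
    rwa [Nat.sub_add_cancel (by omega)]
  have h5 := (hp r).2 (sum_tendsto (fun n => mul_nonneg (hf0 _) (hg0 _)) hc hr2)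
  have h6 : Tendsto (fun j : ℕ => r + j * L) atTop atTop := by
    refine tendsto_atTop_mono (fun j => ?_) tendsto_id
    have := Nat.le_mul_of_pos_right j hLpos
    simp only [id]; omega
  exact h6.frequently h5

end inv

end BHR


namespace BHR

set_option linter.unusedSectionVars false

section inv
variable {X : Type*} {F : MeasurableSpace X} {m0 : MeasurableSpace X} {μ : Measure X}
  [IsProbabilityMeasure μ] {ν : Measure (X × X)} [IsProbabilityMeasure ν] {T S : X → X}

/-- A set of positive measure is visited by the backward orbit, up to small measure, in bounded
time. -/
lemma exists_time (herg : Ergodic T μ) (hTS : Function.LeftInverse T S)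
    (hST : Function.LeftInverse S T) (hS : Measurable S) {A : Set X} (hA : MeasurableSet A)
    (hpos : μ A ≠ 0) {ε : ℝ≥0∞} (hε : 0 < ε) :
    ∃ I : ℕ, μ {x | ∀ i < I, S^[i] x ∉ A} ≤ ε := by
  have hm : ∀ I : ℕ, MeasurableSet {x | ∀ i < I, S^[i] x ∉ A} := by
    intro I
    have : {x | ∀ i < I, S^[i] x ∉ A} = ⋂ i, ⋂ (_ : i < I), (S^[i] ⁻¹' A)ᶜ := by
      ext x; simp
    rw [this]
    exact MeasurableSet.iInter fun i => MeasurableSet.iInter fun _ => ((hS.iterate i) hA).compl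
  have hz : μ (⋂ I : ℕ, {x | ∀ i < I, S^[i] x ∉ A}) = 0 := by
    set B : Set X := {x | ∃ i, S^[i] x ∈ A} with hB
    have hBm : MeasurableSet B := by
      have : B = ⋃ i, S^[i] ⁻¹' A := by ext x; simp [hB]
      rw [this]
      exact MeasurableSet.iUnion fun i => (hS.iterate i) hA
    have hsub : B ⊆ T ⁻¹' B := by
      rintro x ⟨i, hi⟩
      refine ⟨i + 1, ?_⟩
      rw [Function.iterate_succ_apply, hST x]; exact hi
    have hAB : A ⊆ B := fun x hx => ⟨0, hx⟩
    have hBfull := herg.ae_empty_or_univ_of_ae_le_preimage hBm.nullMeasurableSet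
      (LE.le.eventuallyLE hsub)
    rcases hBfull with h | h
    · exact absurd (measure_mono_null hAB (by rw [measure_congr h]; simp)) hpos
    · have : (⋂ I : ℕ, {x | ∀ i < I, S^[i] x ∉ A}) ⊆ Bᶜ := by
        rintro x hx ⟨i, hi⟩
        exact (mem_iInter.1 hx (i + 1)) i (Nat.lt_succ_self i) hi
      refine measure_mono_null this ?_
      rw [measure_congr h.compl]; simp
  have ht := tendsto_measure_iInter_atTop (μ := μ) (s := fun I : ℕ => {x | ∀ i < I, S^[i] x ∉ A})
    (fun I => (hm I).nullMeasurableSet)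
    (fun I J hIJ x hx i hi => hx i (lt_of_lt_of_le hi hIJ)) ⟨0, measure_ne_top _ _⟩
  rw [hz] at ht
  exact ((ht.eventually (gt_mem_nhds hε)).exists).imp fun I hI => hI.le

lemma low_bound (herg : Ergodic T μ) (hTS : Function.LeftInverse T S)
    (hST : Function.LeftInverse S T) (hS : MeasurePreserving S μ μ)
    (hF : F ≤ m0) (hν : CS F μ ν) {f g : ℕ → X → ℝ}
    {u v : X → ℝ} (hf01 : ∀ m x, 0 ≤ f m x ∧ f m x ≤ 1) (hg01 : ∀ m x, 0 ≤ g m x ∧ g m x ≤ 1)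
    (hfm : ∀ m, Measurable (f m)) (hgm : ∀ m, Measurable (g m)) (hum : Measurable u)
    (hu01 : ∀ x, 0 ≤ u x ∧ u x ≤ 1) (hv01 : ∀ x, 0 ≤ v x ∧ v x ≤ 1)
    (hv : ∀ m, Measurable[MeasurableSpace.comap (T^[m]) F] v)
    (hfu : TendstoInMeasure μ f atTop u) (hgv : TendstoInMeasure μ g atTop v)
    (hpos : μ {x | 0 < u x * v x} ≠ 0) {ε : ℝ≥0∞} (hε : 0 < ε) :
    ∃ m : ℕ, ∃ c : ℝ, 0 < c ∧
      ν {p | ¬ ∃ᶠ n in atTop, c ≤ f m (S^[n] p.1) * g m (S^[n] p.2)} ≤ ε + ε + ε := by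
  have hvm : Measurable v := (hv 0).mono (by simpa [MeasurableSpace.comap_id] using hF) le_rfl
  have hvS : ∀ k, Measurable[F] (v ∘ S^[k]) := by
    intro k s hs
    have h1 : MeasurableSet[MeasurableSpace.comap (S^[k]) (MeasurableSpace.comap (T^[k]) F)]
      (S^[k] ⁻¹' (v ⁻¹' s)) := ⟨_, hv k hs, rfl⟩
    rw [comap_iter_cancel hTS le_rfl, Nat.sub_self, Function.iterate_zero,
      MeasurableSpace.comap_id] at h1
    exact h1
  have hveq : ∀ᵐ p ∂ν, ∀ k, v (S^[k] p.1) = v (S^[k] p.2) :=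
    ae_all_iff.2 fun k => CS_eq hF hν (hvS k)
  obtain ⟨c, hc, hA⟩ : ∃ c : ℝ, 0 < c ∧ μ {x | c < u x * v x} ≠ 0 := by
    by_contra hcon
    push Not at hcon
    refine hpos ?_
    have : {x | 0 < u x * v x} ⊆ ⋃ k : ℕ, {x | 1 / ((k : ℝ) + 1) < u x * v x} := by
      intro x hx
      obtain ⟨k, hk⟩ := exists_nat_one_div_lt (show (0:ℝ) < u x * v x from hx)
      exact mem_iUnion.2 ⟨k, hk⟩
    exact measure_mono_null this (measure_iUnion_null fun k => hcon _ (by positivity))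
  obtain ⟨I, hI⟩ := exists_time herg hTS hST hS.measurable
    (measurableSet_lt measurable_const (hum.mul hvm)) hA hε
  have hsm : ∀ {f : ℕ → X → ℝ} {u : X → ℝ}, TendstoInMeasure μ f atTop u →
      ∀ᶠ m in atTop, (I : ℝ≥0∞) * μ {x | c / 4 ≤ dist (f m x) (u x)} ≤ ε := by
    intro f u h
    rw [tendstoInMeasure_iff_dist] at h
    have h1 := ENNReal.Tendsto.const_mul (a := (I : ℝ≥0∞)) (h (c / 4) (by positivity))
      (Or.inr (ENNReal.natCast_ne_top I))
    rw [mul_zero] at h1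
    exact (h1.eventually (gt_mem_nhds hε)).mono fun m hm => hm.le
  obtain ⟨m, hm1, hm2⟩ := ((hsm hfu).and (hsm hgv)).exists
  refine ⟨m, c / 2, by positivity, ?_⟩
  set M : ℕ → Set (X × X) := fun n =>
    {p | ∀ k, n ≤ k → f m (S^[k] p.1) * g m (S^[k] p.2) < c / 2} with hM
  have hMmono : Monotone M := fun a b hab p hp k hk => hp k (hab.trans hk)
  have hset : {p : X × X | ¬ ∃ᶠ n in atTop, c / 2 ≤ f m (S^[n] p.1) * g m (S^[n] p.2)} =
      ⋃ n, M n := by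
    ext p
    simp only [mem_ofPred_eq, not_frequently, not_le, eventually_atTop, hM, mem_iUnion]
  rw [hset, hMmono.measure_iUnion]
  refine iSup_le fun n => ?_
  set D : Set X := {x | c / 4 ≤ dist (f m x) (u x)} with hD
  set D' : Set X := {x | c / 4 ≤ dist (g m x) (v x)} with hD'
  have hDm : MeasurableSet D := measurableSet_le measurable_const ((hfm m).dist hum)
  have hDm' : MeasurableSet D' := measurableSet_le measurable_const ((hgm m).dist hvm)
  set Q : Set X := {x | ∀ i < I, S^[i] x ∉ {x | c < u x * v x}} with hQ
  have hQm : MeasurableSet Q := by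
    have : Q = ⋂ i, ⋂ (_ : i < I), (S^[i] ⁻¹' {x | c < u x * v x})ᶜ := by
      ext x; simp [hQ]
    rw [this]
    exact MeasurableSet.iInter fun i => MeasurableSet.iInter fun _ =>
      ((hS.measurable.iterate i) (measurableSet_lt measurable_const (hum.mul hvm))).compl
  have hcov : M n ⊆ ((fun p : X × X => S^[n] p.1) ⁻¹' Q ∪
      ⋃ i ∈ Finset.range I, (fun p : X × X => S^[i + n] p.1) ⁻¹' D) ∪
      (⋃ i ∈ Finset.range I, (fun p : X × X => S^[i + n] p.2) ⁻¹' D') ∪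
      {p | ¬ ∀ k, v (S^[k] p.1) = v (S^[k] p.2)} := by
    intro p hp
    by_contra hcon
    simp only [mem_union, not_or, mem_iUnion, not_exists, mem_preimage, Finset.mem_range,
      mem_ofPred_eq, not_not] at hcon
    obtain ⟨⟨⟨h1, h2⟩, h3⟩, h4⟩ := hcon
    simp only [hQ, mem_ofPred_eq, not_forall, not_not] at h1
    obtain ⟨i, hi, h5⟩ := h1
    have h6 := h2 i hi
    have h7 := h3 i hi
    have h8 := hp (i + n) (Nat.le_add_left _ _)
    rw [← Function.iterate_add_apply, h4 (i + n)] at h5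
    simp only [hD, hD', mem_ofPred_eq, not_le, Real.dist_eq, abs_lt] at h6 h7
    have a1 := hg01 m (S^[i + n] p.2)
    have a2 := hu01 (S^[i + n] p.1)
    nlinarith [mul_nonneg a1.1 (show 0 ≤ f m (S^[i + n] p.1) - u (S^[i + n] p.1) + c / 4 by linarith),
      mul_nonneg a2.1 (show 0 ≤ g m (S^[i + n] p.2) - v (S^[i + n] p.2) + c / 4 by linarith)]
  have hp1 := CS_fst hF hν
  have hp2 := CS_snd hF hν
  have hb : ∀ {D : Set X} {q : X × X → X}, MeasurableSet D → MeasurePreserving q ν μ →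
      ν (⋃ i ∈ Finset.range I, (fun p : X × X => S^[i + n] (q p)) ⁻¹' D) ≤ I * μ D := by
    intro D q hD hq
    refine (measure_biUnion_finset_le _ _).trans ?_
    have : ∀ i ∈ Finset.range I, ν ((fun p : X × X => S^[i + n] (q p)) ⁻¹' D) = μ D := fun i _ =>
      ((hS.iterate (i + n)).comp hq).measure_preimage hD.nullMeasurableSet
    rw [Finset.sum_congr rfl this]; simp
  have hq1 : ν ((fun p : X × X => S^[n] p.1) ⁻¹' Q) = μ Q :=
    ((hS.iterate n).comp hp1).measure_preimage hQm.nullMeasurableSet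
  have hz : ν {p | ¬ ∀ k, v (S^[k] p.1) = v (S^[k] p.2)} = 0 := ae_iff.1 hveq
  calc ν (M n) ≤ _ := measure_mono hcov
    _ ≤ _ := measure_union_le _ _
    _ ≤ _ := by rw [hz, add_zero]
    _ ≤ _ := measure_union_le _ _
    _ ≤ _ := add_le_add (measure_union_le _ _) le_rfl
    _ ≤ ε + ε + ε := by
      rw [hq1]
      exact add_le_add (add_le_add hI ((hb hDm hp1).trans hm1)) ((hb hDm' hp2).trans hm2)

/-- Dichotomy: either the two sets are separated by a tail set, or they are visited
simultaneously infinitely often. -/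
lemma io_or_sep (herg : Ergodic T μ) (hTS : Function.LeftInverse T S)
    (hST : Function.LeftInverse S T) (hS : MeasurePreserving S μ μ)
    (hF : F ≤ m0) (hTF : MeasurableSpace.comap T F ≤ F) (hν : CS F μ ν) {U V : Set X} {K : ℕ}
    (hK : 0 < K) (hU : MeasurableSet[MeasurableSpace.comap (S^[K]) F] U)
    (hV : MeasurableSet[MeasurableSpace.comap (S^[K]) F] V) :
    (∃ A : Set X, (∀ m, MeasurableSet[MeasurableSpace.comap (T^[m]) F] A) ∧ μ (U \ A) = 0 ∧
      μ (V ∩ A) = 0) ∨ ∀ᵐ p ∂ν, ∃ᶠ n in atTop, S^[n] p.1 ∈ U ∧ S^[n] p.2 ∈ V := by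
  have hU0 : MeasurableSet U := comap_iter_le hF hS.measurable K _ hU
  have hV0 : MeasurableSet V := comap_iter_le hF hS.measurable K _ hV
  have hTm := herg.measurable
  obtain ⟨f, u, hf, hf01, hfe, hu, hu01, hfu, hUu⟩ := tail_lim (μ := μ) (comap_iter_anti hTF)
    (comap_iter_le hF hTm) hU0
  obtain ⟨g, v, hg, hg01, hge, hv, hv01, hgv, hVv⟩ := tail_lim (μ := μ) (comap_iter_anti hTF)
    (comap_iter_le hF hTm) hV0
  by_cases hpos : μ {x | 0 < u x * v x} = 0
  · left
    refine ⟨{x | 0 < u x}, fun m => measurableSet_lt measurable_const (hu m), ?_, ?_⟩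
    · rw [measure_eq_zero_iff_ae_notMem]
      filter_upwards [hUu] with x hx h using h.2 (hx h.1)
    · rw [measure_eq_zero_iff_ae_notMem] at hpos ⊢
      filter_upwards [hVv, hpos] with x hx hx2 h using hx2 (mul_pos h.2 (hx h.1))
  · right
    rw [ae_iff]
    refine le_antisymm (le_of_forall_pos_le_add ?_) bot_le
    intro ε hε
    have hε3 : 0 < ε / 3 := ENNReal.div_pos hε.ne' (by simp)
    obtain ⟨m, c, hc, hle⟩ := low_bound herg hTS hST hS hF hν hf01 hg01
      (fun m => (hf m).mono (comap_iter_le hF hTm m) le_rfl)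
      (fun m => (hg m).mono (comap_iter_le hF hTm m) le_rfl)
      ((hu 0).mono (comap_iter_le hF hTm 0) le_rfl) hu01 hv01 hv hfu hgv hpos hε3
    have hio := EE_io hTS hS hTm hF hTF hν hK hU hV (hfe m) (hge m) (fun x => (hf01 m x).1)
      (fun x => (hg01 m x).1) hc
    rw [zero_add]
    calc _ ≤ ν ({p | ¬ ∃ᶠ n in atTop, c ≤ f m (S^[n] p.1) * g m (S^[n] p.2)} ∪
          {p | ¬ ((∃ᶠ n in atTop, c ≤ f m (S^[n] p.1) * g m (S^[n] p.2)) →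
      ∃ᶠ n in atTop, S^[n] p.1 ∈ U ∧ S^[n] p.2 ∈ V)}) := by
          refine measure_mono fun p hp => ?_
          by_cases h : ∃ᶠ n in atTop, c ≤ f m (S^[n] p.1) * g m (S^[n] p.2)
          · exact Or.inr fun h2 => hp (h2 h)
          · exact Or.inl h
      _ ≤ ε / 3 + ε / 3 + ε / 3 + 0 :=
          (measure_union_le _ _).trans (add_le_add hle (ae_iff.1 hio).le)
      _ = ε := by rw [add_zero, ENNReal.add_thirds]

end inv

end BHR


namespace BHR

set_option linter.unusedSectionVars false

section fin
variable {X : Type*} {F : MeasurableSpace X} [MetricSpace X] [CompactSpace X]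
  {m0 : MeasurableSpace X} [BorelSpace X] {μ : Measure X}
  [IsProbabilityMeasure μ] {ν : Measure (X × X)} [IsProbabilityMeasure ν] {T S : X → X}

lemma cell_meas {c : ℕ} {R : X → Fin c} {N : ℕ} (hTS : Function.LeftInverse T S)
    (hcell : ∀ i, N ≤ i → sg (fun x => R (T^[i] x)) ≤ F) (s : Set (Fin c)) :
    MeasurableSet[MeasurableSpace.comap (S^[N]) F] (R ⁻¹' s) := by
  refine ⟨(fun x => R (T^[N] x)) ⁻¹' s, hcell N le_rfl _ ⟨s, trivial, rfl⟩, ?_⟩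
  ext x
  simp only [mem_preimage]
  rw [(hTS.iterate N) x]

lemma asym_ae (hF : F ≤ m0) (hν : CS F μ ν) {c : ℕ → ℕ} {R : ∀ k, X → Fin (c k)} {N : ℕ → ℕ}
    (hRd : ∀ k x y, R k x = R k y → dist x y < 1 / ((k : ℝ) + 1))
    (hcell : ∀ k i, N k ≤ i → sg (fun x => R k (T^[i] x)) ≤ F) :
    ∀ᵐ p ∂ν, IsAsymptoticPair T p.1 p.2 := by
  have h : ∀ᵐ p ∂ν, ∀ k i, N k ≤ i → R k (T^[i] p.1) = R k (T^[i] p.2) := by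
    rw [ae_all_iff]; intro k
    rw [ae_all_iff]; intro i
    by_cases hi : N k ≤ i
    · have h1 : ∀ᵐ p ∂ν, ∀ j, (p.1 ∈ (fun x => R k (T^[i] x)) ⁻¹' {j} ↔
          p.2 ∈ (fun x => R k (T^[i] x)) ⁻¹' {j}) := by
        rw [ae_all_iff]; intro j
        exact CS_iff hF hν (hcell k i hi _ ⟨{j}, trivial, rfl⟩)
      filter_upwards [h1] with p hp _
      exact ((hp (R k (T^[i] p.1))).1 rfl).symm
    · exact Eventually.of_forall fun p h => absurd h hi
  filter_upwards [h] with p hp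
  unfold IsAsymptoticPair
  rw [Metric.tendsto_atTop]
  intro ε hε
  obtain ⟨k, hk⟩ := exists_nat_one_div_lt hε
  refine ⟨N k, fun i hi => ?_⟩
  rw [Real.dist_0_eq_abs, abs_of_nonneg dist_nonneg]
  exact (hRd k _ _ (hp k i hi)).trans hk

lemma prox_io (herg : Ergodic T μ) (hTS : Function.LeftInverse T S)
    (hST : Function.LeftInverse S T) (hS : MeasurePreserving S μ μ)
    (hF : F ≤ m0) (hTF : MeasurableSpace.comap T F ≤ F) (hν : CS F μ ν) {c : ℕ} {R : X → Fin c}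
    {N : ℕ} (hN : 0 < N) (hcell : ∀ i, N ≤ i → sg (fun x => R (T^[i] x)) ≤ F) :
    ∀ᵐ p ∂ν, ∃ᶠ n in atTop, R (S^[n] p.1) = R (S^[n] p.2) := by
  obtain ⟨j, hj⟩ : ∃ j, μ (R ⁻¹' {j}) ≠ 0 := by
    by_contra hcon
    push Not at hcon
    have h1 : (univ : Set X) ⊆ ⋃ j, R ⁻¹' {j} := fun x _ => mem_iUnion.2 ⟨R x, rfl⟩
    have := measure_mono_null h1 (measure_iUnion_null hcon)
    simp at this
  have hm := cell_meas hTS hcell {j}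
  rcases io_or_sep herg hTS hST hS hF hTF hν hN hm hm with ⟨A, -, h1, h2⟩ | h
  · refine absurd ?_ hj
    have : R ⁻¹' {j} ⊆ (R ⁻¹' {j} \ A) ∪ (R ⁻¹' {j} ∩ A) := by
      rw [sdiff_union_inter]
    exact measure_mono_null this (measure_union_null h1 h2)
  · filter_upwards [h] with p hp
    exact hp.mono fun n hn => (show R (S^[n] p.1) = j from hn.1).trans
      (show R (S^[n] p.2) = j from hn.2).symm

lemma far_io (herg : Ergodic T μ) (hTS : Function.LeftInverse T S)
    (hST : Function.LeftInverse S T) (hS : MeasurePreserving S μ μ)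
    (hF : F ≤ m0) (hTF : MeasurableSpace.comap T F ≤ F) (hν : CS F μ ν) {c : ℕ} {R : X → Fin c}
    {N : ℕ} (hN : 0 < N) {ε : ℝ} (hε : 0 < ε) (hRd : ∀ x y, R x = R y → dist x y < ε)
    (hcell : ∀ i, N ≤ i → sg (fun x => R (T^[i] x)) ≤ F)
    (hzero : ∀ A, (∀ m, MeasurableSet[MeasurableSpace.comap (T^[m]) F] A) →
      partKS μ T (ptn A) = 0) {x0 y0 : X} (hxy : IsMuEntropyPair T μ x0 y0)
    (hd : 4 * ε ≤ dist x0 y0) :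
    ∀ᵐ p ∂ν, ∃ᶠ n in atTop, dist x0 y0 - 4 * ε ≤ dist (S^[n] p.1) (S^[n] p.2) := by
  set U := R ⁻¹' (R '' Metric.ball x0 ε) with hU
  set V := R ⁻¹' (R '' Metric.ball y0 ε) with hV
  have near : ∀ {x z : X}, x ∈ R ⁻¹' (R '' Metric.ball z ε) → dist x z < 2 * ε := by
    rintro x z ⟨w, hw, hwx⟩
    have h1 := hRd x w hwx.symm
    have h2 : dist w z < ε := hw
    linarith [dist_triangle x w z]
  have hUm := cell_meas hTS hcell (R '' Metric.ball x0 ε)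
  have hVm := cell_meas hTS hcell (R '' Metric.ball y0 ε)
  have hU0 : MeasurableSet U := comap_iter_le hF hS.measurable N _ hUm
  have hV0 : MeasurableSet V := comap_iter_le hF hS.measurable N _ hVm
  have hdisj : ∀ x, x ∈ U → x ∉ V := by
    intro x h1 h2
    have a1 := near h1
    have a2 := near h2
    have := dist_triangle_left x0 y0 x
    linarith
  have hbU : Metric.ball x0 ε ⊆ U := subset_preimage_image R _
  have hbV : Metric.ball y0 ε ⊆ V := subset_preimage_image R _
  rcases io_or_sep herg hTS hST hS hF hTF hν hN hUm hVm with ⟨A, hAm, h1, h2⟩ | h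
  · exfalso
    have hA0 : MeasurableSet A := comap_iter_le hF herg.measurable 0 _ (hAm 0)
    have hB : MeasurableSet ((A ∪ U) \ V) := (hA0.union hU0).diff hV0
    have hx0 : x0 ∈ interior ((A ∪ U) \ V) := by
      rw [mem_interior]
      exact ⟨_, fun x hx => ⟨Or.inr (hbU hx), hdisj x (hbU hx)⟩, Metric.isOpen_ball,
        Metric.mem_ball_self hε⟩
    have hy0 : y0 ∈ interior ((A ∪ U) \ V)ᶜ := by
      rw [mem_interior]
      exact ⟨_, fun x hx h => h.2 (hbV hx), Metric.isOpen_ball, Metric.mem_ball_self hε⟩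
    have hpos : 0 < partKS μ T (ptn ((A ∪ U) \ V)) := hxy.2 _ hB hx0 hy0
    have hle := ks_le herg.toMeasurePreserving (MP_ptn hB) (MP_ptn hA0)
    have hae : ptn ((A ∪ U) \ V) =ᵐ[μ] ptn A := by
      rw [measure_eq_zero_iff_ae_notMem] at h1 h2
      filter_upwards [h1, h2] with x hx1 hx2
      have : x ∈ (A ∪ U) \ V ↔ x ∈ A :=
        ⟨fun h => h.1.elim id fun hu => by_contra fun ha => hx1 ⟨hu, ha⟩,
          fun h => ⟨Or.inl h, fun hv => hx2 ⟨hv, h⟩⟩⟩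
      simp only [ptn, this]
    rw [hzero A hAm, entropy_congr_ae hae, ent_zero (sg_ptn_le hA0) le_rfl] at hle
    linarith
  · filter_upwards [h] with p hp
    refine hp.mono fun n hn => ?_
    have a1 := near hn.1
    have a2 := near hn.2
    have a3 := dist_triangle4 x0 (S^[n] p.1) (S^[n] p.2) y0
    rw [dist_comm x0 (S^[n] p.1)] at a3
    linarith

lemma bdd_dist (x y : ℕ → X) :
    IsBoundedUnder (· ≤ ·) atTop (fun n => dist (x n) (y n)) ∧
    IsBoundedUnder (· ≥ ·) atTop (fun n => dist (x n) (y n)) := by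
  refine ⟨⟨Metric.diam (univ : Set X), ?_⟩, ⟨0, ?_⟩⟩
  · simp only [eventually_map]
    exact Eventually.of_forall fun n =>
      Metric.dist_le_diam_of_mem isCompact_univ.isBounded (mem_univ _) (mem_univ _)
  · simp only [eventually_map]
    exact Eventually.of_forall fun n => dist_nonneg

lemma final_ae (herg : Ergodic T μ) (hTS : Function.LeftInverse T S)
    (hST : Function.LeftInverse S T) (hS : MeasurePreserving S μ μ)
    (hF : F ≤ m0) (hTF : MeasurableSpace.comap T F ≤ F) (hν : CS F μ ν)
    {c : ℕ → ℕ} {R : ∀ k, X → Fin (c k)} {N : ℕ → ℕ} (hN : ∀ k, 0 < N k)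
    (hRd : ∀ k x y, R k x = R k y → dist x y < 1 / ((k : ℝ) + 1))
    (hcell : ∀ k i, N k ≤ i → sg (fun x => R k (T^[i] x)) ≤ F)
    (hzero : ∀ A, (∀ m, MeasurableSet[MeasurableSpace.comap (T^[m]) F] A) →
      partKS μ T (ptn A) = 0) {δ : ℝ} (hδ0 : 0 < δ)
    (hδ : ∀ r < δ, ∃ x y, IsMuEntropyPair T μ x y ∧ r < dist x y) :
    ∀ᵐ p ∂ν, IsAsymptoticPair T p.1 p.2 ∧
        Filter.liminf (fun n : ℕ => dist (S^[n] p.1) (S^[n] p.2)) atTop = 0 ∧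
        δ ≤ Filter.limsup (fun n : ℕ => dist (S^[n] p.1) (S^[n] p.2)) atTop ∧
        ¬ IsAsymptoticPair S p.1 p.2 := by
  have h1 := asym_ae hF hν hRd hcell
  have h2 : ∀ᵐ p ∂ν, ∀ k, ∃ᶠ n in atTop, R k (S^[n] p.1) = R k (S^[n] p.2) :=
    ae_all_iff.2 fun k => prox_io herg hTS hST hS hF hTF hν (hN k) (hcell k)
  have h3 : ∀ᵐ p ∂ν, ∀ q : ℕ, ∃ᶠ n in atTop,
      δ - 1 / ((q : ℝ) + 1) ≤ dist (S^[n] p.1) (S^[n] p.2) := by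
    rw [ae_all_iff]
    intro q
    have hq : (0:ℝ) < 1 / ((q : ℝ) + 1) := by positivity
    set r : ℝ := max (δ / 2) (δ - 1 / ((q : ℝ) + 1) / 2) with hr
    obtain ⟨x, y, hxy, hlt⟩ := hδ r (max_lt (by linarith) (by linarith))
    have e1 : δ / 2 ≤ r := le_max_left _ _
    have e2 : δ - 1 / ((q : ℝ) + 1) / 2 ≤ r := le_max_right _ _
    obtain ⟨k, hk⟩ := exists_nat_one_div_lt
      (show 0 < min (δ / 8) (1 / ((q : ℝ) + 1) / 8) from lt_min (by linarith) (by linarith))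
    have e3 := hk.trans_le (min_le_left _ _)
    have e4 := hk.trans_le (min_le_right _ _)
    have h4 := far_io herg hTS hST hS hF hTF hν (hN k) (show (0:ℝ) < 1 / ((k : ℝ) + 1) by positivity)
      (hRd k) (hcell k) hzero hxy (by linarith)
    filter_upwards [h4] with p hp
    exact hp.mono fun n hn => by linarith
  filter_upwards [h1, h2, h3] with p hp1 hp2 hp3
  obtain ⟨b1, b2⟩ := bdd_dist (fun n => S^[n] p.1) (fun n => S^[n] p.2)
  have hls : δ ≤ Filter.limsup (fun n : ℕ => dist (S^[n] p.1) (S^[n] p.2)) atTop := by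
    refine le_of_forall_pos_le_add fun ε hε => ?_
    obtain ⟨q, hq⟩ := exists_nat_one_div_lt hε
    have := le_limsup_of_frequently_le (hp3 q) b1
    linarith
  refine ⟨hp1, le_antisymm ?_ ?_, hls, fun has => ?_⟩
  · refine le_of_forall_pos_le_add fun ε hε => ?_
    obtain ⟨k, hk⟩ := exists_nat_one_div_lt hε
    rw [zero_add]
    exact liminf_le_of_frequently_le
      ((hp2 k).mono fun n hn => ((hRd k _ _ hn).trans hk).le) b2
  · exact le_liminf_of_le b1.isCoboundedUnder_ge (Eventually.of_forall fun n => dist_nonneg)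
  · have := Tendsto.limsup_eq has
    rw [this] at hls
    linarith

end fin

end BHR

/-- Let `μ` be a `T`-ergodic measure of positive entropy and let
`δ = sup { d(x,y) : (x,y) ∈ E_μ(X,T) }`. Then `δ > 0` and there is a Borel probability
measure `ν` on `X × X`, both of whose coordinate projections equal `μ`, such that
`ν`-almost every pair `(x,y)` is asymptotic for `T`, satisfies
`liminf d(T⁻ⁿx, T⁻ⁿy) = 0` and `limsup d(T⁻ⁿx, T⁻ⁿy) ≥ δ`; in particular `ν`-almost
every pair is a Li–Yorke pair for `T⁻¹`. -/
theorem asymptotic_and_LiYorke_for_inverse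
    {X : Type*} [MetricSpace X] [CompactSpace X] [MeasurableSpace X] [BorelSpace X]
    (T : X ≃ₜ X) (μ : Measure X) [IsProbabilityMeasure μ]
    (herg : Ergodic (⇑T) μ) (hpos : 0 < ksEntropy μ (⇑T))
    (δ : ℝ) (hδ : δ = sSup ((fun p : X × X => dist p.1 p.2) ''
      {p : X × X | IsMuEntropyPair (⇑T) μ p.1 p.2})) :
    0 < δ ∧
    ∃ ν : Measure (X × X), IsProbabilityMeasure ν ∧
      ν.map Prod.fst = μ ∧ ν.map Prod.snd = μ ∧
      (∀ᵐ p ∂ν,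
        IsAsymptoticPair (⇑T) p.1 p.2 ∧
        Filter.liminf (fun n : ℕ => dist ((⇑T.symm)^[n] p.1) ((⇑T.symm)^[n] p.2)) atTop = 0 ∧
        δ ≤ Filter.limsup (fun n : ℕ => dist ((⇑T.symm)^[n] p.1) ((⇑T.symm)^[n] p.2)) atTop ∧
        ¬ IsAsymptoticPair (⇑T.symm) p.1 p.2) := by
  have : Nonempty X := nonempty_of_isProbabilityMeasure μ
  have hTm : MeasurePreserving (⇑T) μ μ := herg.toMeasurePreserving
  have hTS : Function.LeftInverse (⇑T) (⇑T.symm) := T.apply_symm_apply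
  have hST : Function.LeftInverse (⇑T.symm) (⇑T) := T.symm_apply_apply
  have hS : MeasurePreserving (⇑T.symm) μ μ := by
    have := MeasurePreserving.symm T.toMeasurableEquiv hTm
    exact this
  have hbdd : BddAbove ((fun p : X × X => dist p.1 p.2) ''
      {p : X × X | IsMuEntropyPair (⇑T) μ p.1 p.2}) := by
    refine ⟨Metric.diam (univ : Set X), ?_⟩
    rintro _ ⟨p, -, rfl⟩
    exact Metric.dist_le_diam_of_mem isCompact_univ.isBounded (mem_univ _) (mem_univ _)
  obtain ⟨x0, y0, hxy⟩ := BHR.exists_entropyPair hTm hpos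
  have hmem : dist x0 y0 ∈ (fun p : X × X => dist p.1 p.2) ''
      {p : X × X | IsMuEntropyPair (⇑T) μ p.1 p.2} := ⟨(x0, y0), hxy, rfl⟩
  have hδ0 : 0 < δ := by
    rw [hδ]
    exact lt_of_lt_of_le (dist_pos.2 hxy.1) (le_csSup hbdd hmem)
  have hδ' : ∀ r < δ, ∃ x y, IsMuEntropyPair (⇑T) μ x y ∧ r < dist x y := by
    intro r hr
    rw [hδ] at hr
    obtain ⟨_, ⟨p, hp, rfl⟩, hlt⟩ := exists_lt_of_lt_csSup ⟨_, hmem⟩ hr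
    exact ⟨p.1, p.2, hp, hlt⟩
  refine ⟨hδ0, ?_⟩
  choose c R hR hRd using fun k : ℕ =>
    BHR.exists_part (X := X) (show (0:ℝ) < 1 / ((k : ℝ) + 1) by positivity)
  obtain ⟨n, hn⟩ := BHR.exists_alg hTm R hR
  have hF : (⨆ k, BHR.fut (⇑T) (R k) (n k + 1)) ≤ (‹MeasurableSpace X› : MeasurableSpace X) :=
    iSup_le fun k => BHR.fut_le hTm.measurable (hR k) _
  have hTF : MeasurableSpace.comap (⇑T) (⨆ k, BHR.fut (⇑T) (R k) (n k + 1)) ≤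
      ⨆ k, BHR.fut (⇑T) (R k) (n k + 1) := by
    rw [MeasurableSpace.comap_iSup]
    refine iSup_mono fun k => ?_
    rw [BHR.comap_fut_one]
    exact BHR.fut_anti _ _ (Nat.le_succ _)
  obtain ⟨ν, hνp, hν⟩ := BHR.exists_CS (μ := μ) hF
  refine ⟨ν, hνp, (BHR.CS_fst hF hν).map_eq, (BHR.CS_snd hF hν).map_eq, ?_⟩
  exact BHR.final_ae herg hTS hST hS hF hTF hν (N := fun k => n k + 1) (fun k => Nat.succ_pos _)
    hRd (fun k i hi => (BHR.sg_le_fut (⇑T) (R k) hi).trans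
      (le_iSup (fun k => BHR.fut (⇑T) (R k) (n k + 1)) k)) hn hδ0 hδ'
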